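/- Let k be a field, c ≥ 1 an integer, q = (q_{ij}) a c×c commutation matrix over k (q_{ii} = 1 and q_{ij}q_{ji} = 1 for all i,j) all of whose entries q_{ij} are roots of unity, and a_1, …, a_c integers with each a_i ≥ 2. Let A = A_q^a be the associated quantum complete intersection, ℤ^c-graded with deg x_i the i-th standard basis vector. Then for all finitely generated ℤ^c-graded left A-modules M and N, the following are equivalent: (i) Ext_A^i(M,N) = 0 for all sufficiently large i; (ii) Ext_A^i(M,N) = 0 for all i > 0; (iii) Ext_A^i(N,M) = 0 for all sufficiently large i; (iv) Ext_A^i(N,M) = 0 for all i > 0. -/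

import Mathlib

/-!
Ext-symmetry for graded modules over a quantum complete intersection whose commutators
are roots of unity (Theorem `symmetrygraded` in the paper).  The `ℤ^c`-grading on
`A = A_q^a` (with `deg x_i` the `i`-th standard basis vector) is given as a
`GradedAlgebra` datum `𝒜`, and the graded modules are given by decompositions
`ℳ`, `𝒩` compatible with `𝒜`.
-/

noncomputable section

open CategoryTheory DirectSum

/-- The defining relations of the quantum complete intersection `A_q^a`:
`X_i ^ (a i) = 0` and `X_i * X_j = q i j • (X_j * X_i)`. -/
def qciRel (k : Type) [Field k] (c : ℕ) (q : Fin c → Fin c → k) (a : Fin c → ℕ) :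
    FreeAlgebra k (Fin c) → FreeAlgebra k (Fin c) → Prop := fun x y =>
  (∃ i, x = FreeAlgebra.ι k i ^ a i ∧ y = 0) ∨
  (∃ i j, x = FreeAlgebra.ι k i * FreeAlgebra.ι k j ∧
    y = q i j • (FreeAlgebra.ι k j * FreeAlgebra.ι k i))

/-- The quantum complete intersection `A_q^a = k⟨X_1,…,X_c⟩/(X_i^{a_i}, X_iX_j - q_{ij}X_jX_i)`. -/
abbrev QCI (k : Type) [Field k] (c : ℕ) (q : Fin c → Fin c → k) (a : Fin c → ℕ) : Type :=
  RingQuot (qciRel k c q a)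

/-- The generator `x_i` of `A_q^a` (the image of `X_i`). -/
def qciX (k : Type) [Field k] {c : ℕ} (q : Fin c → Fin c → k) (a : Fin c → ℕ) (i : Fin c) :
    QCI k c q a :=
  RingQuot.mkAlgHom k (qciRel k c q a) (FreeAlgebra.ι k i)

/-- `Ext_A^i(M, N) = 0`. -/
def extVanish (A : Type) [Ring A] (M N : Type) [AddCommGroup M] [Module A M]
    [AddCommGroup N] [Module A N] (i : ℕ) : Prop :=
  Subsingleton
    (((Ext ℤ (ModuleCat A) i).obj (Opposite.op (ModuleCat.of A M))).obj (ModuleCat.of A N))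

open CategoryTheory DirectSum

instance qciHasExt (A : Type) [Ring A] : HasExt.{0} (ModuleCat.{0} A) :=
  hasExt_of_enoughProjectives.{0} (ModuleCat.{0} A)

lemma ab_ext_iff {A : Type} [Ring A] {X : ModuleCat.{0} A} (P : ProjectiveResolution X)
    (Y : ModuleCat.{0} A) (n : ℕ) :
    Subsingleton (Abelian.Ext X Y (n+1)) ↔
    ∀ f : P.complex.X (n+1) ⟶ Y, P.complex.d (n+2) (n+1) ≫ f = 0 →
      ∃ g : P.complex.X n ⟶ Y, P.complex.d (n+1) n ≫ g = f := by
  constructor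
  · intro h f hf
    have h0 : P.extMk f (n+2) rfl hf = 0 := Subsingleton.elim _ _
    rwa [P.extMk_eq_zero_iff f (n+2) rfl hf n rfl] at h0
  · intro h
    refine subsingleton_of_forall_eq 0 fun α => ?_
    obtain ⟨f, hf, rfl⟩ := P.extMk_surjective α (n+2) rfl
    rw [P.extMk_eq_zero_iff f (n+2) rfl hf n rfl]
    exact h f hf

lemma old_ext_iff {A : Type} [Ring A] {X : ModuleCat.{0} A} (P : ProjectiveResolution X)
    (Y : ModuleCat.{0} A) (n : ℕ) :
    Subsingleton (((Ext ℤ (ModuleCat A) (n+1)).obj (Opposite.op X)).obj Y) ↔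
    ∀ f : P.complex.X (n+1) ⟶ Y, P.complex.d (n+2) (n+1) ≫ f = 0 →
      ∃ g : P.complex.X n ⟶ Y, P.complex.d (n+1) n ≫ g = f := by
  rw [← ModuleCat.isZero_iff_subsingleton, (P.isoExt (n+1) Y).isZero_iff,
    ← HomologicalComplex.exactAt_iff_isZero_homology,
    HomologicalComplex.exactAt_iff' _ n (n+1) (n+2) (by simp) (by simp),
    ShortComplex.moduleCat_exact_iff]
  rfl

lemma extVanish_iff {A : Type} [Ring A] (M N : Type) [AddCommGroup M] [Module A M]
    [AddCommGroup N] [Module A N] (n : ℕ) :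
    extVanish A M N (n+1) ↔
      Subsingleton (Abelian.Ext (ModuleCat.of A M) (ModuleCat.of A N) (n+1)) := by
  rw [extVanish, old_ext_iff (projectiveResolution _), ab_ext_iff (projectiveResolution _)]

open CategoryTheory DirectSum

/-- Vanishing of the (derived category) Ext groups. -/
def Ev (A : Type) [Ring A] (M N : Type) [AddCommGroup M] [Module A M]
    [AddCommGroup N] [Module A N] (n : ℕ) : Prop :=
  Subsingleton (Abelian.Ext (ModuleCat.of A M) (ModuleCat.of A N) n)

section SES
variable {A : Type} [Ring A] {L E M N : Type} [AddCommGroup L] [Module A L]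
  [AddCommGroup E] [Module A E] [AddCommGroup M] [Module A M] [AddCommGroup N] [Module A N]

/-- the short complex -/
abbrev sesOf (i : L →ₗ[A] E) (p : E →ₗ[A] M) (hex : Function.Exact i p) :
    ShortComplex (ModuleCat.{0} A) :=
  ShortComplex.mk (ModuleCat.ofHom i) (ModuleCat.ofHom p) (by
    ext x; simpa using hex.apply_apply_eq_zero x)

lemma sesOf_shortExact (i : L →ₗ[A] E) (p : E →ₗ[A] M) (hex : Function.Exact i p)
    (hi : Function.Injective i) (hp : Function.Surjective p) :
    (sesOf i p hex).ShortExact where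
  exact := (ShortComplex.ShortExact.moduleCat_exact_iff_function_exact _).mpr hex
  mono_f := (ModuleCat.mono_iff_injective _).2 hi
  epi_g := (ModuleCat.epi_iff_surjective _).2 hp

variable {i : L →ₗ[A] E} {p : E →ₗ[A] M} (hex : Function.Exact i p)
    (hi : Function.Injective i) (hp : Function.Surjective p)

include hex hi hp

lemma ses_surj_i {n : ℕ} (h : Ev A M N (n+1))
    (x : Abelian.Ext (ModuleCat.of A L) (ModuleCat.of A N) n) :
    ∃ y : Abelian.Ext (ModuleCat.of A E) (ModuleCat.of A N) n,
      (Abelian.Ext.mk₀ (ModuleCat.ofHom i)).comp y (zero_add n) = x := by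
  have hS := sesOf_shortExact i p hex hi hp
  exact Abelian.Ext.contravariant_sequence_exact₁ hS _ x (n₁ := n+1) (add_comm _ _)
    (@Subsingleton.elim _ h _ _)

lemma ses_surj_p {n : ℕ} (h : Ev A L N n)
    (x : Abelian.Ext (ModuleCat.of A E) (ModuleCat.of A N) n) :
    ∃ y : Abelian.Ext (ModuleCat.of A M) (ModuleCat.of A N) n,
      (Abelian.Ext.mk₀ (ModuleCat.ofHom p)).comp y (zero_add n) = x := by
  have hS := sesOf_shortExact i p hex hi hp
  exact Abelian.Ext.contravariant_sequence_exact₂ hS _ x (@Subsingleton.elim _ h _ _)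

lemma ses_shift_down {n : ℕ} (hE : Ev A E N n) (h : Ev A M N (n+1)) : Ev A L N n := by
  refine @subsingleton_of_forall_eq _ 0 fun x => ?_
  obtain ⟨y, rfl⟩ := ses_surj_i hex hi hp h x
  rw [@Subsingleton.elim _ hE y 0, Abelian.Ext.comp_zero]

lemma ses_shift_up {n : ℕ} (hE : Ev A E N (n+1)) (h : Ev A L N n) : Ev A M N (n+1) := by
  have hS := sesOf_shortExact i p hex hi hp
  refine @subsingleton_of_forall_eq _ 0 fun x => ?_
  obtain ⟨y, hy⟩ := Abelian.Ext.contravariant_sequence_exact₃ hS _ x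
    (@Subsingleton.elim _ hE _ _) (n₀ := n) (add_comm _ _)
  rw [← hy, @Subsingleton.elim _ h y 0, Abelian.Ext.comp_zero]

lemma ses_extend (h : Ev A M N 1) (f : L →ₗ[A] N) : ∃ g : E →ₗ[A] N, g ∘ₗ i = f := by
  obtain ⟨y, hy⟩ := ses_surj_i hex hi hp h (Abelian.Ext.mk₀ (ModuleCat.ofHom f))
  obtain ⟨g, rfl⟩ := (Abelian.Ext.mk₀_bijective _ _).2 y
  rw [Abelian.Ext.mk₀_comp_mk₀] at hy
  have := (Abelian.Ext.mk₀_bijective _ _).1 hy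
  refine ⟨g.hom, ?_⟩
  have h2 := congrArg ModuleCat.Hom.hom this
  simpa using h2

lemma ses_of_extend (hE : Ev A E N 1) (h : ∀ f : L →ₗ[A] N, ∃ g : E →ₗ[A] N, g ∘ₗ i = f) :
    Ev A M N 1 := by
  have hS := sesOf_shortExact i p hex hi hp
  refine @subsingleton_of_forall_eq _ 0 fun x => ?_
  obtain ⟨y, hy⟩ := Abelian.Ext.contravariant_sequence_exact₃ hS _ x
    (@Subsingleton.elim _ hE _ _) (n₀ := 0) (add_comm _ _)
  obtain ⟨f, rfl⟩ := (Abelian.Ext.mk₀_bijective _ _).2 y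
  obtain ⟨g, hg⟩ := h f.hom
  have hf : f = (sesOf i p hex).f ≫ ModuleCat.ofHom g := by
    ext x
    exact (LinearMap.congr_fun hg x).symm
  rw [← hy, hf, ← Abelian.Ext.mk₀_comp_mk₀]
  exact hS.extClass_comp_assoc _
end SES

lemma ev_of_lift {A : Type} [Ring A] {M N : Type} [AddCommGroup M] [Module A M] [AddCommGroup N]
    [Module A N] [Module.Projective A M] (n : ℕ) : Ev A M N (n+1) := by
  have : Projective (ModuleCat.of A M) := (IsProjective.iff_projective _).1 inferInstance
  exact Abelian.Ext.subsingleton_of_projective _ _ n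

/-- an exact sequence `0 → M → E → E → M → 0` -/
structure Per (A : Type) [Ring A] (M E : Type) [AddCommGroup E] [Module A E]
    [AddCommGroup M] [Module A M] (ι : M →ₗ[A] E) (d : E →ₗ[A] E) (π : E →ₗ[A] M) : Prop where
  inj : Function.Injective ι
  ex1 : Function.Exact ι d
  ex2 : Function.Exact d π
  surj : Function.Surjective π
  nil : IsNilpotent d

section PER
variable {A : Type} [Ring A] {E M N : Type}
  [AddCommGroup E] [Module A E] [AddCommGroup M] [Module A M] [AddCommGroup N] [Module A N]
  {ι : M →ₗ[A] E} {d : E →ₗ[A] E} {π : E →ₗ[A] M} (P : Per A M E ι d π)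

include P

omit P in
lemma ker_ses1 : Function.Exact (LinearMap.ker π).subtype π := LinearMap.exact_subtype_ker_map π

/-- corestriction of `d` -/
def Per.d' : E →ₗ[A] LinearMap.ker π :=
  d.codRestrict _ (fun x => P.ex2.apply_apply_eq_zero x)

lemma Per.ses2 : Function.Exact ι P.d' := by
  intro x
  rw [← P.ex1 x]
  exact Subtype.ext_iff

lemma Per.d'_surj : Function.Surjective P.d' := by
  rintro ⟨x, hx⟩
  obtain ⟨y, hy⟩ := (P.ex2 x).1 hx
  exact ⟨y, Subtype.ext hy⟩

lemma Per.d_eq : (LinearMap.ker π).subtype ∘ₗ P.d' = d := by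
  ext x; rfl

lemma Per.ev_E {n₀ : ℕ} (h : ∀ n ≥ n₀, Ev A M N n) (n : ℕ) (hn : n ≥ n₀) : Ev A E N n := by
  have key : ∀ x : Abelian.Ext (ModuleCat.of A E) (ModuleCat.of A N) n,
      ∃ y, (Abelian.Ext.mk₀ (ModuleCat.ofHom d)).comp y (zero_add n) = x := by
    intro x
    obtain ⟨y, rfl⟩ := ses_surj_p P.ses2 P.inj P.d'_surj (h n hn) x
    obtain ⟨z, rfl⟩ := ses_surj_i (ker_ses1 (π := π)) (Submodule.subtype_injective _) P.surj
      (h (n+1) (by omega)) y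
    refine ⟨z, ?_⟩
    rw [Abelian.Ext.mk₀_comp_mk₀_assoc, ← ModuleCat.ofHom_comp, P.d_eq]
  have key2 : ∀ (m : ℕ) (x : Abelian.Ext (ModuleCat.of A E) (ModuleCat.of A N) n),
      ∃ y, (Abelian.Ext.mk₀ (ModuleCat.ofHom (d ^ m))).comp y (zero_add n) = x := by
    intro m
    induction m with
    | zero =>
      intro x
      refine ⟨x, ?_⟩
      exact Abelian.Ext.mk₀_id_comp x
    | succ m ih =>
      intro x
      obtain ⟨y, rfl⟩ := key x
      obtain ⟨z, rfl⟩ := ih y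
      refine ⟨z, ?_⟩
      rw [Abelian.Ext.mk₀_comp_mk₀_assoc, ← ModuleCat.ofHom_comp]
      rfl
  obtain ⟨m, hm⟩ := P.nil
  refine @subsingleton_of_forall_eq _ 0 fun x => ?_
  obtain ⟨y, rfl⟩ := key2 m x
  rw [hm]
  change (Abelian.Ext.mk₀ 0).comp y _ = 0
  rw [Abelian.Ext.mk₀_zero, Abelian.Ext.zero_comp]

lemma Per.down (hE : ∀ n, Ev A E N (n+1)) (n : ℕ) (h : Ev A M N (n+3)) : Ev A M N (n+1) :=
  ses_shift_down P.ses2 P.inj P.d'_surj (hE n)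
    (ses_shift_down (ker_ses1 (π := π)) (Submodule.subtype_injective _) P.surj (hE (n+1)) h)

lemma Per.all (hE : ∀ n, Ev A E N (n+1)) {n₀ : ℕ} (h : ∀ n ≥ n₀, Ev A M N n) (n : ℕ) :
    Ev A M N (n+1) := by
  have : ∀ j n, n + 2 * j ≥ n₀ → Ev A M N (n+1) := by
    intro j
    induction j with
    | zero => intro n hn; exact h _ (by omega)
    | succ j ih => intro n hn; exact P.down hE n (ih (n+2) (by omega))
  exact this n₀ n (by omega)

lemma Per.exact_of_ev (hE : ∀ n, Ev A E N (n+1)) (h1 : Ev A M N 1) (h2 : Ev A M N 2) :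
    (∀ f : E →ₗ[A] N, f ∘ₗ d = 0 → ∃ h : E →ₗ[A] N, h ∘ₗ ι ∘ₗ π = f) ∧
    (∀ f : E →ₗ[A] N, f ∘ₗ ι ∘ₗ π = 0 → ∃ h : E →ₗ[A] N, h ∘ₗ d = f) := by
  have hL : Ev A (LinearMap.ker π) N 1 :=
    ses_shift_down (ker_ses1 (π := π)) (Submodule.subtype_injective _) P.surj (hE 0) h2
  constructor
  · intro f hf
    have hk : LinearMap.ker π ≤ LinearMap.ker f := by
      intro x hx
      obtain ⟨y, rfl⟩ := (P.ex2 x).1 hx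
      exact LinearMap.congr_fun hf y
    obtain ⟨g, hg⟩ : ∃ g : M →ₗ[A] N, g ∘ₗ π = f := by
      refine ⟨(LinearMap.ker π).liftQ f hk ∘ₗ (π.quotKerEquivOfSurjective P.surj).symm, ?_⟩
      ext x
      simp only [LinearMap.comp_apply, LinearEquiv.coe_coe]
      rw [show (π.quotKerEquivOfSurjective P.surj).symm (π x) = Submodule.Quotient.mk x by
        rw [LinearEquiv.symm_apply_eq]; rfl]
      rfl
    obtain ⟨h, hh⟩ := ses_extend P.ses2 P.inj P.d'_surj hL g
    refine ⟨h, ?_⟩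
    rw [← hg, ← hh]; rfl
  · intro f hf
    have hk : LinearMap.ker P.d' ≤ LinearMap.ker f := by
      intro x hx
      obtain ⟨y, rfl⟩ := (P.ses2 x).1 hx
      obtain ⟨z, rfl⟩ := P.surj y
      exact LinearMap.congr_fun hf z
    obtain ⟨g, hg⟩ : ∃ g : LinearMap.ker π →ₗ[A] N, g ∘ₗ P.d' = f := by
      refine ⟨(LinearMap.ker P.d').liftQ f hk ∘ₗ
        (P.d'.quotKerEquivOfSurjective P.d'_surj).symm, ?_⟩
      ext x
      simp only [LinearMap.comp_apply, LinearEquiv.coe_coe]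
      rw [show (P.d'.quotKerEquivOfSurjective P.d'_surj).symm (P.d' x)
        = Submodule.Quotient.mk x by
        rw [LinearEquiv.symm_apply_eq]; rfl]
      rfl
    obtain ⟨h, hh⟩ := ses_extend (ker_ses1 (π := π)) (Submodule.subtype_injective _) P.surj h1 g
    refine ⟨h, ?_⟩
    rw [← hg, ← hh]; rfl

lemma Per.ev_of_exact (hE : ∀ n, Ev A E N (n+1))
    (h1 : ∀ f : E →ₗ[A] N, f ∘ₗ d = 0 → ∃ h : E →ₗ[A] N, h ∘ₗ ι ∘ₗ π = f)
    (h2 : ∀ f : E →ₗ[A] N, f ∘ₗ ι ∘ₗ π = 0 → ∃ h : E →ₗ[A] N, h ∘ₗ d = f) (n : ℕ) :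
    Ev A M N (n+1) := by
  have e1 : Ev A M N 1 := by
    refine ses_of_extend (ker_ses1 (π := π)) (Submodule.subtype_injective _) P.surj (hE 0) fun f => ?_
    obtain ⟨h, hh⟩ := h2 (f ∘ₗ P.d') (by
      ext x
      have : P.d' (ι (π x)) = 0 := P.ses2.apply_apply_eq_zero _
      simp [this])
    refine ⟨h, ?_⟩
    ext x
    obtain ⟨y, rfl⟩ := P.d'_surj x
    exact LinearMap.congr_fun hh y
  have e2 : Ev A (LinearMap.ker π) N 1 := by
    refine ses_of_extend P.ses2 P.inj P.d'_surj (hE 0) fun f => ?_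
    obtain ⟨h, hh⟩ := h1 (f ∘ₗ π) (by
      ext x
      simp [P.ex2.apply_apply_eq_zero x])
    refine ⟨h, ?_⟩
    ext x
    obtain ⟨y, rfl⟩ := P.surj x
    exact LinearMap.congr_fun hh y
  have key : ∀ n, Ev A M N (n+1) ∧ Ev A (LinearMap.ker π) N (n+1) := by
    intro n
    induction n with
    | zero => exact ⟨e1, e2⟩
    | succ n ih =>
      exact ⟨ses_shift_up (ker_ses1 (π := π)) (Submodule.subtype_injective _) P.surj (hE _) ih.2,
        ses_shift_up P.ses2 P.inj P.d'_surj (hE _) ih.1⟩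
  exact (key n).1
end PER

open CategoryTheory DirectSum

/-- A representation of the quantum complete intersection by operators. -/
structure IsRep {k : Type} [Field k] {c : ℕ} (q : Fin c → Fin c → k) (a : Fin c → ℕ)
    {N : Type} [AddCommGroup N] [Module k N] (Y : Fin c → Module.End k N) : Prop where
  pow : ∀ i, Y i ^ a i = 0
  comm : ∀ i j, Y i * Y j = q i j • (Y j * Y i)

/-- A representation with scaling automorphisms. -/
structure TM (k : Type) [Field k] (c : ℕ) (q : Fin c → Fin c → k) (a : Fin c → ℕ) where
  V : Type
  [acg : AddCommGroup V]
  [mod : Module k V]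
  X : Fin c → Module.End k V
  Θ : Fin c → (Module.End k V)ˣ
  rep : IsRep q a X
  Θcomm : ∀ i j, Commute (Θ i) (Θ j)
  ΘX : ∀ i j, (Θ i : Module.End k V) * X j = q i j • (X j * (Θ i : Module.End k V))

attribute [instance] TM.acg TM.mod

section RepA
variable {k : Type} [Field k] {c : ℕ} {q : Fin c → Fin c → k} {a : Fin c → ℕ}

/-- The algebra map attached to a representation. -/
def IsRep.hom {N : Type} [AddCommGroup N] [Module k N] {Y : Fin c → Module.End k N}
    (h : IsRep q a Y) : QCI k c q a →ₐ[k] Module.End k N :=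
  RingQuot.liftAlgHom k ⟨FreeAlgebra.lift k Y, by
    rintro x y (⟨i, rfl, rfl⟩ | ⟨i, j, rfl, rfl⟩)
    · simp [h.pow i]
    · simp [h.comm i j]⟩

lemma IsRep.hom_X {N : Type} [AddCommGroup N] [Module k N] {Y : Fin c → Module.End k N}
    (h : IsRep q a Y) (i : Fin c) : h.hom (qciX k q a i) = Y i := by
  simp [IsRep.hom, qciX]

/-- The operators on a module. -/
def opN (q : Fin c → Fin c → k) (a : Fin c → ℕ) (N : Type) [AddCommGroup N]
    [Module (QCI k c q a) N] [Module k N] [IsScalarTower k (QCI k c q a) N] (i : Fin c) :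
    Module.End k N := Algebra.lsmul k k N (qciX k q a i)

lemma opN_apply (N : Type) [AddCommGroup N]
    [Module (QCI k c q a) N] [Module k N] [IsScalarTower k (QCI k c q a) N] (i : Fin c) (n : N) :
    opN q a N i n = qciX k q a i • n := rfl

lemma qciX_pow (i : Fin c) : qciX k q a i ^ a i = 0 := by
  have := RingQuot.mkAlgHom_rel k (s := qciRel k c q a) (Or.inl ⟨i, rfl, rfl⟩)
  simpa [qciX] using this

lemma qciX_comm (i j : Fin c) :
    qciX k q a i * qciX k q a j = q i j • (qciX k q a j * qciX k q a i) := by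
  have := RingQuot.mkAlgHom_rel k (s := qciRel k c q a) (Or.inr ⟨i, j, rfl, rfl⟩)
  simpa [qciX] using this

lemma opN_rep (N : Type) [AddCommGroup N]
    [Module (QCI k c q a) N] [Module k N] [IsScalarTower k (QCI k c q a) N] :
    IsRep q a (opN q a N) where
  pow i := by
    rw [opN, ← map_pow, qciX_pow, map_zero]
  comm i j := by
    simp only [opN]
    rw [← map_mul, qciX_comm, map_smul, map_mul]

lemma qci_induction {P : QCI k c q a → Prop} (h0 : ∀ r : k, P (algebraMap k _ r))
    (hX : ∀ i, P (qciX k q a i)) (hmul : ∀ x y, P x → P y → P (x * y))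
    (hadd : ∀ x y, P x → P y → P (x + y)) (x : QCI k c q a) : P x := by
  obtain ⟨z, rfl⟩ := RingQuot.mkAlgHom_surjective k (qciRel k c q a) x
  induction z using FreeAlgebra.induction with
  | grade0 r => simpa using h0 r
  | grade1 i => exact hX i
  | mul x y hx hy => rw [map_mul]; exact hmul _ _ hx hy
  | add x y hx hy => rw [map_add]; exact hadd _ _ hx hy

/-- Linear maps from maps commuting with the operators. -/
def mkLin {P Q : Type} [AddCommGroup P] [AddCommGroup Q] [Module (QCI k c q a) P] [Module k P]
    [IsScalarTower k (QCI k c q a) P] [Module (QCI k c q a) Q] [Module k Q]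
    [IsScalarTower k (QCI k c q a) Q] (f : P →ₗ[k] Q)
    (h : ∀ i p, f (opN q a P i p) = opN q a Q i (f p)) : P →ₗ[QCI k c q a] Q where
  toFun := f
  map_add' := f.map_add
  map_smul' x := by
    simp only [opN_apply] at h
    induction x using qci_induction with
    | h0 r => intro p; simp
    | hX i => exact h i
    | hmul x y hx hy => intro p; simp only [RingHom.id_apply] at *; rw [mul_smul, hx, hy, mul_smul]
    | hadd x y hx hy =>
      intro p; simp only [RingHom.id_apply] at *; rw [add_smul, map_add, hx, hy, add_smul]

/-- The module attached to a representation. -/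
def TM.Mod (T : TM k c q a) : Type := T.V

instance (T : TM k c q a) : AddCommGroup T.Mod := T.acg
instance (T : TM k c q a) : Module k T.Mod := T.mod
instance (T : TM k c q a) : Module (QCI k c q a) T.Mod :=
  Module.compHom T.V (T.rep.hom : QCI k c q a →+* Module.End k T.V)

lemma TM.smul_def (T : TM k c q a) (x : QCI k c q a) (v : T.Mod) :
    x • v = (T.rep.hom x : Module.End k T.V) v := rfl

instance (T : TM k c q a) : IsScalarTower k (QCI k c q a) T.Mod where
  smul_assoc r x v := by
    rw [T.smul_def, T.smul_def, map_smul]; rfl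

lemma TM.opN_eq (T : TM k c q a) (i : Fin c) : opN q a T.Mod i = T.X i := by
  ext v
  rw [opN_apply, T.smul_def, T.rep.hom_X]
  rfl

end RepA

open CategoryTheory DirectSum

section Ops
variable {k : Type} [Field k] {V : Type} [AddCommGroup V] [Module k V] {n : ℕ}

/-- pointwise action -/
def sl (n : ℕ) : Module.End k V →ₐ[k] Module.End k (Fin n → V) where
  toFun φ := φ.compLeft (Fin n)
  map_one' := rfl
  map_mul' _ _ := rfl
  map_zero' := rfl
  map_add' _ _ := rfl
  commutes' _ := rfl

@[simp] lemma sl_apply (φ : Module.End k V) (f : Fin n → V) (s : Fin n) :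
    sl n φ f s = φ (f s) := rfl

/-- shift -/
def sh (k : Type) [Field k] (V : Type) [AddCommGroup V] [Module k V] (n : ℕ) :
    Module.End k (Fin n → V) where
  toFun f s := if s.val = 0 then 0 else f ⟨s.val - 1, by omega⟩
  map_add' f g := by ext s; by_cases h : s.val = 0 <;> simp [h]
  map_smul' r f := by ext s; by_cases h : s.val = 0 <;> simp [h]

lemma sh_apply (f : Fin n → V) (s : Fin n) :
    sh k V n f s = if s.val = 0 then 0 else f ⟨s.val - 1, by omega⟩ := rfl

/-- diagonal scaling -/
def dg (V : Type) [AddCommGroup V] [Module k V] (n : ℕ) (u : k) :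
    Module.End k (Fin n → V) where
  toFun f s := u ^ s.val • f s
  map_add' f g := by ext s; simp
  map_smul' r f := by ext s; simp [smul_smul, mul_comm]

@[simp] lemma dg_apply (u : k) (f : Fin n → V) (s : Fin n) :
    dg V n u f s = u ^ s.val • f s := rfl

lemma sh_sl (φ : Module.End k V) : Commute (sh k V n) (sl n φ) := by
  refine LinearMap.ext fun f => funext fun s => ?_
  simp only [Module.End.mul_apply, sh_apply, sl_apply]
  split_ifs <;> simp

lemma dg_sl (u : k) (φ : Module.End k V) : Commute (dg V n u) (sl n φ) := by
  refine LinearMap.ext fun f => funext fun s => ?_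
  simp [Module.End.mul_apply]

lemma dg_dg (u v : k) : dg V n u * dg V n v = dg V n (u * v) := by
  refine LinearMap.ext fun f => funext fun s => ?_
  simp [Module.End.mul_apply, mul_pow, smul_smul]

lemma dg_one : dg V n (1 : k) = 1 := by
  refine LinearMap.ext fun f => funext fun s => ?_
  simp

lemma dg_sh (u : k) : dg V n u * sh k V n = u • (sh k V n * dg V n u) := by
  refine LinearMap.ext fun f => funext fun s => ?_
  simp only [Module.End.mul_apply, sh_apply, dg_apply, LinearMap.smul_apply, Pi.smul_apply]
  split_ifs with h
  · simp
  · rw [smul_smul, ← pow_succ']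
    congr 2; omega

lemma sh_pow_apply (m : ℕ) (f : Fin n → V) (s : Fin n) :
    (sh k V n ^ m) f s = if s.val < m then 0 else f ⟨s.val - m, by omega⟩ := by
  induction m generalizing s with
  | zero => simp
  | succ m ih =>
    rw [pow_succ', Module.End.mul_apply, sh_apply]
    split_ifs with h1 h2 h2
    · rfl
    · omega
    · rw [ih]; simp; omega
    · rw [ih, if_neg (by simp; omega)]
      congr 2; simp; omega

lemma sh_pow_n : sh k V n ^ n = 0 := by
  refine LinearMap.ext fun f => funext fun s => ?_
  rw [sh_pow_apply, if_pos s.2]; rfl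

lemma single_ext {P : Type} [AddCommGroup P] [Module k P] {f g : (Fin n → V) →ₗ[k] P}
    (h : ∀ s v, f (Pi.single s v) = g (Pi.single s v)) : f = g :=
  LinearMap.pi_ext h

lemma sl_single (φ : Module.End k V) (s : Fin n) (v : V) :
    sl n φ (Pi.single s v) = Pi.single s (φ v) := by
  ext r
  by_cases h : r = s
  · subst h; simp
  · simp [h]

lemma dg_single (u : k) (s : Fin n) (v : V) :
    dg V n u (Pi.single s v) = u ^ s.val • Pi.single s v := by
  ext r
  by_cases h : r = s
  · subst h; simp
  · simp [h]

lemma sh_single (s : ℕ) (hs : s + 1 < n) (v : V) :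
    sh k V n (Pi.single (⟨s, by omega⟩ : Fin n) v) = Pi.single ⟨s+1, hs⟩ v := by
  ext r
  rw [sh_apply]
  simp only [Pi.single_apply, Fin.ext_iff]
  split_ifs <;> first | rfl | omega

/-- `sum_s Y^s g φ^s` -/
def exm {P : Type} [AddCommGroup P] [Module k P] (n : ℕ) (Y : Module.End k P)
    (φ : Module.End k V) (g : V →ₗ[k] P) : (Fin n → V) →ₗ[k] P :=
  ∑ s : Fin n, ((Y ^ s.val) ∘ₗ g ∘ₗ (φ ^ s.val)) ∘ₗ LinearMap.proj s

lemma exm_apply {P : Type} [AddCommGroup P] [Module k P] (Y : Module.End k P)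
    (φ : Module.End k V) (g : V →ₗ[k] P) (f : Fin n → V) :
    exm n Y φ g f = ∑ s : Fin n, (Y ^ s.val) (g ((φ ^ s.val) (f s))) := by
  simp [exm, LinearMap.sum_apply]

lemma exm_single {P : Type} [AddCommGroup P] [Module k P] (Y : Module.End k P)
    (φ : Module.End k V) (g : V →ₗ[k] P) (s : Fin n) (v : V) :
    exm n Y φ g (Pi.single s v) = (Y ^ s.val) (g ((φ ^ s.val) v)) := by
  rw [exm_apply, Finset.sum_eq_single s]
  · simp
  · intro r _ hr; simp [hr]
  · simp

/-- the kernel inclusion -/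
def iot (n : ℕ) (y : Module.End k V) : V →ₗ[k] (Fin n → V) :=
  LinearMap.pi fun s => y ^ (n - 1 - s.val)

@[simp] lemma iot_apply (y : Module.End k V) (v : V) (s : Fin n) :
    iot n y v s = (y ^ (n - 1 - s.val)) v := rfl

lemma iot_eq_sum (y : Module.End k V) (v : V) :
    iot n y v = ∑ s : Fin n, Pi.single s ((y ^ (n - 1 - s.val)) v) := by
  ext s
  simp [Finset.sum_apply, Pi.single_apply]

lemma iot_inj (hn : 0 < n) (y : Module.End k V) : Function.Injective (iot n y) := by
  intro v w h
  have := congrFun h ⟨n-1, by omega⟩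
  simpa using this

lemma ex_iot (hn : 0 < n) (y : Module.End k V) (hy : y ^ n = 0) :
    Function.Exact (iot n y) (sh k V n - sl n y) := by
  intro f
  constructor
  · intro hf
    have h1 : ∀ s : ℕ, ∀ hs : s + 1 < n, f ⟨s, by omega⟩ = y (f ⟨s+1, hs⟩) := by
      intro s hs
      have := congrFun hf ⟨s+1, hs⟩
      simpa [sh_apply, sub_eq_zero] using this
    refine ⟨f ⟨n-1, by omega⟩, ?_⟩
    have h2 : ∀ t : ℕ, ∀ ht : t < n, (y ^ t) (f ⟨n-1, by omega⟩) = f ⟨n-1-t, by omega⟩ := by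
      intro t
      induction t with
      | zero => intro _; rfl
      | succ t ih =>
        intro ht
        rw [pow_succ', Module.End.mul_apply, ih (by omega), h1 (n-1-(t+1)) (by omega)]
        congr 3; omega
    ext s
    rw [iot_apply, h2 _ (by omega)]
    congr 2; omega
  · rintro ⟨v, rfl⟩
    ext s
    simp only [LinearMap.sub_apply, Pi.sub_apply, sh_apply, sl_apply, iot_apply, Pi.zero_apply]
    rw [← Module.End.mul_apply, ← pow_succ']
    split_ifs with h
    · rw [h, show n - 1 - 0 + 1 = n by omega, hy]; simp
    · rw [show n - 1 - s.val + 1 = n - 1 - (s.val - 1) by omega, sub_self]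

lemma ex_pi (hn : 0 < n) (y : Module.End k V) (hy : y ^ n = 0) :
    Function.Exact (sh k V n - sl n y) (exm n y 1 (LinearMap.id : V →ₗ[k] V)) := by
  intro f
  constructor
  · intro hf
    have key : ∀ s : ℕ, ∀ hs : s < n, ∀ v, Pi.single (⟨s, hs⟩ : Fin n) v -
        Pi.single (⟨0, hn⟩ : Fin n) ((y ^ s) v) ∈ LinearMap.range (sh k V n - sl n y) := by
      intro s
      induction s with
      | zero => intro hs v; simp
      | succ s ih =>
        intro hs v
        have h1 : Pi.single (⟨s+1, hs⟩ : Fin n) v - Pi.single (⟨s, by omega⟩ : Fin n) (y v)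
            ∈ LinearMap.range (sh k V n - sl n y) := by
          refine ⟨Pi.single ⟨s, by omega⟩ v, ?_⟩
          rw [LinearMap.sub_apply, sh_single s hs, sl_single]
        have := Submodule.add_mem _ h1 (ih (by omega) (y v))
        rw [pow_succ, Module.End.mul_apply]
        simpa using this
    have hsum := Submodule.sum_mem (LinearMap.range (sh k V n - sl n y)) (t := Finset.univ)
      (f := fun s : Fin n => Pi.single s (f s) - Pi.single (⟨0, hn⟩ : Fin n) ((y ^ s.val) (f s)))
      (fun s _ => key s.val s.2 (f s))
    rw [Finset.sum_sub_distrib, Finset.univ_sum_single] at hsum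
    have h0 : ∑ s : Fin n, Pi.single (⟨0, hn⟩ : Fin n) ((y ^ s.val) (f s))
        = (0 : Fin n → V) := by
      have := congrArg (fun v => (Pi.single (⟨0, hn⟩ : Fin n) v : Fin n → V)) hf
      simp only [exm_apply, one_pow, Module.End.one_apply, LinearMap.id_apply, Pi.single_zero]
        at this
      rw [← this]
      exact (map_sum (LinearMap.single k (fun _ : Fin n => V) ⟨0, hn⟩) _ _).symm
    rw [h0, sub_zero] at hsum
    exact hsum
  · rintro ⟨g, rfl⟩
    suffices h : exm n y 1 (LinearMap.id : V →ₗ[k] V) ∘ₗ (sh k V n - sl n y) = 0 from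
      LinearMap.congr_fun h g
    apply single_ext
    intro s v
    simp only [LinearMap.comp_apply, LinearMap.sub_apply, sl_single, map_sub, exm_single,
      one_pow, Module.End.one_apply, LinearMap.id_apply, LinearMap.zero_apply]
    rw [← Module.End.mul_apply, ← pow_succ]
    by_cases h : s.val + 1 < n
    · rw [sh_single s.val h, exm_single]; simp
    · have h2 : s.val + 1 = n := by omega
      rw [h2, hy]
      have : sh k V n (Pi.single s v) = 0 := by
        ext r
        rw [sh_apply]
        simp only [Pi.single_apply, Fin.ext_iff, Pi.zero_apply]
        split_ifs <;> first | rfl | omega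
      rw [this]; simp

lemma d_nil (y : Module.End k V) (hy : y ^ n = 0) : IsNilpotent (sh k V n - sl n y) := by
  refine Commute.isNilpotent_sub (sh_sl y) ⟨n, sh_pow_n⟩ ⟨n, ?_⟩
  rw [← map_pow, hy, map_zero]
end Ops

open CategoryTheory DirectSum

section EE
variable {k : Type} [Field k] {c : ℕ} {q : Fin c → Fin c → k} {a : Fin c → ℕ}

lemma TM.XΘ (hqc : ∀ i j, q i j * q j i = 1) (T : TM k c q a) (i j : Fin c) :
    T.X j * (T.Θ i : Module.End k T.V) = q j i • ((T.Θ i : Module.End k T.V) * T.X j) := by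
  rw [T.ΘX, smul_smul, hqc, one_smul]

lemma TM.ΘiX (hqc : ∀ i j, q i j * q j i = 1) (T : TM k c q a) (i j : Fin c) :
    (↑(T.Θ i)⁻¹ : Module.End k T.V) * T.X j =
      q j i • (T.X j * (↑(T.Θ i)⁻¹ : Module.End k T.V)) := by
  rw [Units.inv_mul_eq_iff_eq_mul, mul_smul_comm, ← mul_assoc, ← smul_mul_assoc, ← T.XΘ hqc,
    mul_assoc, Units.mul_inv, mul_one]

/-- the induced module -/
abbrev TM.E (hqd : ∀ i, q i i = 1) (hqc : ∀ i j, q i j * q j i = 1) (T : TM k c q a) (i : Fin c) :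
    TM k c q a where
  V := Fin (a i) → T.V
  X j := if j = i then sl (a i) (T.Θ i : Module.End k T.V) * sh k T.V (a i)
    else sl (a i) (T.X j)
  Θ j := ⟨sl (a i) (T.Θ j : Module.End k T.V) * dg T.V (a i) (q j i),
    sl (a i) (↑(T.Θ j)⁻¹ : Module.End k T.V) * dg T.V (a i) (q i j), by
      rw [mul_assoc, ← mul_assoc (dg _ _ _), (dg_sl _ _).eq, mul_assoc, dg_dg, hqc, dg_one, mul_one,
        ← map_mul, Units.mul_inv, map_one], by
      rw [mul_assoc, ← mul_assoc (dg _ _ _), (dg_sl _ _).eq, mul_assoc, dg_dg, hqc, dg_one, mul_one,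
        ← map_mul, Units.inv_mul, map_one]⟩
  rep := by
    constructor
    · intro j
      split_ifs with h
      · subst h
        rw [(sh_sl _).symm.mul_pow, sh_pow_n, mul_zero]
      · rw [← map_pow, T.rep.pow, map_zero]
    · intro j l
      split_ifs with h1 h2 h2
      · rw [h1, h2, hqd, one_smul]
      · subst h1
        rw [mul_assoc, (sh_sl _).eq, ← mul_assoc, ← map_mul, T.ΘX, map_smul, smul_mul_assoc,
          map_mul, mul_assoc]
      · subst h2
        rw [← mul_assoc, ← map_mul, T.XΘ hqc, map_smul, smul_mul_assoc, map_mul, mul_assoc,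
          mul_assoc, (sh_sl _).eq]
      · rw [← map_mul, T.rep.comm, map_smul, map_mul]
  Θcomm j l := by
    apply Units.ext
    simp only [Units.val_mul]
    rw [mul_assoc, ← mul_assoc (dg _ _ _), (dg_sl _ _).eq, mul_assoc, dg_dg, 
      mul_assoc (sl (a i) _), ← mul_assoc (dg _ _ _), (dg_sl _ _).eq, mul_assoc, dg_dg, ← mul_assoc,
      ← mul_assoc, ← map_mul, ← map_mul, mul_comm (q j i)]
    congr 2
    exact congrArg Units.val (T.Θcomm j l)
  ΘX j l := by
    dsimp only
    split_ifs with h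
    · subst h
      rw [mul_assoc, ← mul_assoc (dg _ _ _), (dg_sl _ _).eq, mul_assoc, dg_sh, mul_smul_comm,
        mul_smul_comm, ← mul_assoc, ← map_mul, show (T.Θ j : Module.End k T.V) * T.Θ l = T.Θ l * T.Θ j from
          congrArg Units.val (T.Θcomm j l), mul_assoc, ← mul_assoc (sh _ _ _), (sh_sl _).eq, map_mul,
          mul_assoc, mul_assoc]
    · rw [mul_assoc, (dg_sl _ _).eq, ← mul_assoc, ← map_mul, T.ΘX, map_smul, map_mul, smul_mul_assoc,
        mul_assoc]

/-- the twisted operator -/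
def TM.y (T : TM k c q a) (i : Fin c) : Module.End k T.V := T.X i * (↑(T.Θ i)⁻¹ : Module.End k T.V)

lemma TM.y_X (hqc : ∀ i j, q i j * q j i = 1) (T : TM k c q a) (i j : Fin c) :
    Commute (T.y i) (T.X j) := by
  rw [Commute, SemiconjBy, TM.y, mul_assoc, T.ΘiX hqc, mul_smul_comm, ← mul_assoc, ← mul_assoc,
    ← smul_mul_assoc, ← T.rep.comm]

lemma TM.y_Θ (hqd : ∀ i, q i i = 1) (T : TM k c q a) (i : Fin c) :
    Commute (T.y i) (T.Θ i : Module.End k T.V) := by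
  rw [Commute, SemiconjBy, TM.y, mul_assoc, Units.inv_mul, mul_one, ← mul_assoc, T.ΘX, hqd, one_smul,
    mul_assoc, Units.mul_inv, mul_one]

lemma TM.X_Θi (hqd : ∀ i, q i i = 1) (hqc : ∀ i j, q i j * q j i = 1) (T : TM k c q a) (i : Fin c) :
    Commute (T.X i) (↑(T.Θ i)⁻¹ : Module.End k T.V) := by
  rw [Commute, SemiconjBy, T.ΘiX hqc, hqd, one_smul]

lemma TM.y_pow (hqd : ∀ i, q i i = 1) (hqc : ∀ i j, q i j * q j i = 1) (T : TM k c q a) (i : Fin c) :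
    T.y i ^ a i = 0 := by
  rw [TM.y, (T.X_Θi hqd hqc i).mul_pow, T.rep.pow, zero_mul]

lemma TM.X_y (hqd : ∀ i, q i i = 1) (T : TM k c q a) (i : Fin c) :
    T.X i = (T.Θ i : Module.End k T.V) * T.y i := by
  rw [← (T.y_Θ hqd i).eq, TM.y, mul_assoc, Units.inv_mul, mul_one]

variable (hqd : ∀ i, q i i = 1) (hqc : ∀ i j, q i j * q j i = 1)

lemma TM.E_X_self (T : TM k c q a) (i : Fin c) :
    (T.E hqd hqc i).X i = sl (a i) (T.Θ i : Module.End k T.V) * sh k T.V (a i) := by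
  simp [TM.E]

lemma TM.E_X_ne (T : TM k c q a) {i j : Fin c} (h : j ≠ i) :
    (T.E hqd hqc i).X j = sl (a i) (T.X j) := by
  simp [TM.E, h]

/-- commuting with the `l`-th operators -/
def Cm (M N : TM k c q a) (l : Fin c) (g : M.V →ₗ[k] N.V) : Prop :=
  ∀ m, g (M.X l m) = N.X l (g m)

/-- bundled linear map -/
def mkTM {M N : TM k c q a} (g : M.V →ₗ[k] N.V) (h : ∀ l, Cm M N l g) :
    M.Mod →ₗ[QCI k c q a] N.Mod :=
  mkLin (P := M.Mod) (Q := N.Mod) (q := q) (a := a) g (fun i p => by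
    rw [TM.opN_eq, TM.opN_eq]; exact h i p)

/-- the underlying linear map -/
def unTM {M N : TM k c q a} (f : M.Mod →ₗ[QCI k c q a] N.Mod) : M.V →ₗ[k] N.V :=
  f.restrictScalars k

lemma unTM_Cm {M N : TM k c q a} (f : M.Mod →ₗ[QCI k c q a] N.Mod) (l : Fin c) :
    Cm M N l (unTM f) := by
  intro m
  have h1 := LinearMap.congr_fun (M.opN_eq l) m
  have h2 := LinearMap.congr_fun (N.opN_eq l) (f m)
  exact ((congrArg f h1).symm.trans (f.map_smul (qciX k q a l) m)).trans h2

/-- differential -/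
def TM.d (T : TM k c q a) (i : Fin c) : (T.E hqd hqc i).V →ₗ[k] (T.E hqd hqc i).V :=
  sh k T.V (a i) - sl (a i) (T.y i)
/-- projection -/
def TM.π (T : TM k c q a) (i : Fin c) : (T.E hqd hqc i).V →ₗ[k] T.V :=
  exm (a i) (T.y i) 1 (LinearMap.id : T.V →ₗ[k] T.V)
/-- inclusion -/
def TM.ι (T : TM k c q a) (i : Fin c) : T.V →ₗ[k] (T.E hqd hqc i).V := iot (a i) (T.y i)

lemma TM.d_Cm (T : TM k c q a) (i l : Fin c) :
    Cm (T.E hqd hqc i) (T.E hqd hqc i) l (T.d hqd hqc i) := by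
  have : Commute (sh k T.V (a i) - sl (a i) (T.y i)) ((T.E hqd hqc i).X l) := by
    apply Commute.sub_left
    · by_cases h : l = i
      · subst h
        rw [T.E_X_self]
        exact (sh_sl _).mul_right (Commute.refl _)
      · rw [T.E_X_ne _ _ h]
        exact sh_sl _
    · by_cases h : l = i
      · subst h
        rw [T.E_X_self]
        exact ((T.y_Θ hqd l).map (sl (a l))).mul_right (sh_sl _).symm
      · rw [T.E_X_ne _ _ h]
        exact (T.y_X hqc i l).map (sl (a i))
  exact fun m => LinearMap.congr_fun this.eq m

lemma TM.π_surj (ha : ∀ i, 2 ≤ a i) (T : TM k c q a) (i : Fin c) :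
    Function.Surjective (T.π hqd hqc i) := by
  intro v
  refine ⟨(Pi.single ⟨0, by have := ha i; omega⟩ v : Fin (a i) → T.V), ?_⟩
  rw [TM.π, exm_single]; simp

lemma TM.π_Cm (T : TM k c q a) (i l : Fin c) :
    Cm (T.E hqd hqc i) T l (T.π hqd hqc i) := by
  by_cases h : l = i
  · subst h
    -- π d = 0
    intro m
    have h1 : ∀ m, T.π hqd hqc l (sh k T.V (a l) m) = T.π hqd hqc l (sl (a l) (T.y l) m) := by
      intro m
      rw [← sub_eq_zero, ← map_sub]
      by_cases hn : 0 < a l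
      · exact (ex_pi hn (T.y l) (T.y_pow hqd hqc l)).apply_apply_eq_zero m
      · have : IsEmpty (Fin (a l)) := by
          rw [show a l = 0 by omega]; infer_instance
        have : ∀ f : Fin (a l) → T.V, T.π hqd hqc l f = 0 := by
          intro f
          rw [Subsingleton.elim f 0, map_zero]
        exact this _
    have h2 : ∀ φ : Module.End k T.V, Commute (T.y l) φ →
        ∀ m, T.π hqd hqc l (sl (a l) φ m) = φ (T.π hqd hqc l m) := by
      intro φ hφ m
      simp only [TM.π, exm_apply, map_sum, one_pow, Module.End.one_apply, LinearMap.id_apply, sl_apply]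
      refine Finset.sum_congr rfl fun s _ => ?_
      exact LinearMap.congr_fun (hφ.pow_left s.val).eq (m s)
    rw [T.E_X_self, ← (sh_sl _).eq, Module.End.mul_apply, h1, ← Module.End.mul_apply, ← map_mul,
      (T.y_Θ hqd l).eq, ← T.X_y hqd, h2 _ (T.y_X hqc l l)]
  · intro m
    rw [T.E_X_ne _ _ h]
    simp only [TM.π, exm_apply, map_sum, one_pow, Module.End.one_apply, LinearMap.id_apply, sl_apply]
    refine Finset.sum_congr rfl fun s _ => ?_
    exact LinearMap.congr_fun ((T.y_X hqc i l).pow_left s.val).eq (m s)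

lemma TM.ι_Cm (T : TM k c q a) (i l : Fin c) :
    Cm T (T.E hqd hqc i) l (T.ι hqd hqc i) := by
  by_cases h : l = i
  · subst h
    intro m
    have h1 : ∀ m, sh k T.V (a l) (iot (a l) (T.y l) m) = sl (a l) (T.y l) (iot (a l) (T.y l) m) := by
      intro m
      rw [← sub_eq_zero, ← LinearMap.sub_apply]
      by_cases hn : 0 < a l
      · exact (ex_iot hn (T.y l) (T.y_pow hqd hqc l)).apply_apply_eq_zero m
      · have : IsEmpty (Fin (a l)) := by
          rw [show a l = 0 by omega]; infer_instance
        exact Subsingleton.elim _ _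
    have h3 : (T.E hqd hqc l).X l (T.ι hqd hqc l m) =
      sl (a l) (T.X l) (iot (a l) (T.y l) m) := by
      rw [T.E_X_self, Module.End.mul_apply, TM.ι, h1, ← Module.End.mul_apply, ← map_mul,
        ← T.X_y hqd]
    rw [h3]
    refine funext fun s => ?_
    exact LinearMap.congr_fun ((T.y_X hqc l l).pow_left _).eq m
  · intro m
    rw [T.E_X_ne _ _ h]
    refine funext fun s => ?_
    exact LinearMap.congr_fun ((T.y_X hqc i l).pow_left _).eq m

lemma TM.per (ha : ∀ i, 2 ≤ a i) (T : TM k c q a) (i : Fin c) :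
    Per (QCI k c q a) T.Mod (T.E hqd hqc i).Mod (mkTM (T.ι hqd hqc i) (T.ι_Cm hqd hqc i))
      (mkTM (T.d hqd hqc i) (T.d_Cm hqd hqc i)) (mkTM (T.π hqd hqc i) (T.π_Cm hqd hqc i)) := by
  have hn : 0 < a i := by have := ha i; omega
  refine ⟨iot_inj hn (T.y i), ex_iot hn (T.y i) (T.y_pow hqd hqc i),
    ex_pi hn (T.y i) (T.y_pow hqd hqc i), T.π_surj hqd hqc ha i, ?_⟩
  obtain ⟨m, hm⟩ := d_nil (T.y i) (T.y_pow hqd hqc i) 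
  refine ⟨m, LinearMap.ext fun v => ?_⟩
  have : ∀ m, ((mkTM (T.d hqd hqc i) (T.d_Cm hqd hqc i)) ^ m : Module.End (QCI k c q a) (T.E hqd hqc i).Mod) v
     = (((sh k T.V (a i) - sl (a i) (T.y i)) ^ m : Module.End k (Fin (a i) → T.V)) v : Fin (a i) → T.V) := by
    intro m
    induction m with
    | zero => rfl
    | succ m ih => rw [pow_succ', pow_succ', Module.End.mul_apply, ih]; rfl
  rw [this, hm]; rfl
end EE

open CategoryTheory DirectSum

section UU
variable {k : Type} [Field k] {c : ℕ} {q : Fin c → Fin c → k} {a : Fin c → ℕ}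
  (hqd : ∀ i, q i i = 1) (hqc : ∀ i j, q i j * q j i = 1) (ha : ∀ i, 2 ≤ a i)

/-- intertwining -/
def It {V P : Type} [AddCommGroup V] [Module k V] [AddCommGroup P] [Module k P]
    (X : Module.End k V) (Y : Module.End k P) (g : V →ₗ[k] P) : Prop := ∀ m, g (X m) = Y (g m)

lemma qpow {R : Type} [Ring R] [Algebra k R] {A B : R} {r : k} (h : A * B = r • (B * A)) (s : ℕ) :
    A ^ s * B = r ^ s • (B * A ^ s) := by
  induction s with
  | zero => simp
  | succ s ih =>
    rw [pow_succ', mul_assoc, ih, mul_smul_comm, ← mul_assoc, h, smul_mul_assoc, smul_smul, mul_assoc,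
      pow_succ]

lemma qpow' {R : Type} [Ring R] [Algebra k R] {A B : R} {r : k} (h : A * B = r • (B * A)) (s : ℕ) :
    A * B ^ s = r ^ s • (B ^ s * A) := by
  induction s with
  | zero => simp
  | succ s ih =>
    rw [pow_succ, ← mul_assoc, ih, smul_mul_assoc, mul_assoc, h, mul_smul_comm, smul_smul, mul_assoc,
      pow_succ]

/-- the extension -/
def TM.ext (T : TM k c q a) (i : Fin c) {P : Type} [AddCommGroup P] [Module k P]
    (Y : Module.End k P) (g : T.V →ₗ[k] P) : (T.E hqd hqc i).V →ₗ[k] P :=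
  exm (a i) Y (↑(T.Θ i)⁻¹ : Module.End k T.V) g

/-- zeroth slot -/
def TM.s0 (T : TM k c q a) (i : Fin c) : T.V →ₗ[k] (T.E hqd hqc i).V :=
  LinearMap.single k (fun _ : Fin (a i) => T.V) ⟨0, by have := ha i; omega⟩

lemma TM.s0_apply (T : TM k c q a) (i : Fin c) (v : T.V) :
    T.s0 hqd hqc ha i v = (Pi.single ⟨0, by have := ha i; omega⟩ v : Fin (a i) → T.V) := rfl

lemma TM.ext_s0 (T : TM k c q a) (i : Fin c) {P : Type} [AddCommGroup P] [Module k P]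
    (Y : Module.End k P) (g : T.V →ₗ[k] P) :
    T.ext hqd hqc i Y g ∘ₗ T.s0 hqd hqc ha i = g := by
  ext v
  rw [LinearMap.comp_apply, TM.s0_apply, TM.ext, exm_single]
  simp

lemma sh_last {V : Type} [AddCommGroup V] [Module k V] {n : ℕ} (s : Fin n) (h : ¬ s.val + 1 < n)
    (v : V) : sh k V n (Pi.single s v) = 0 := by
  ext r
  rw [sh_apply]
  simp only [Pi.single_apply, Fin.ext_iff, Pi.zero_apply]
  split_ifs <;> first | rfl | omega

lemma TM.ext_self (T : TM k c q a) (i : Fin c) {P : Type} [AddCommGroup P] [Module k P]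
    (Y : Module.End k P) (hY : Y ^ a i = 0) (g : T.V →ₗ[k] P) :
    It ((T.E hqd hqc i).X i) Y (T.ext hqd hqc i Y g) := by
  intro m
  suffices h : T.ext hqd hqc i Y g ∘ₗ (T.E hqd hqc i).X i = Y ∘ₗ T.ext hqd hqc i Y g from
    LinearMap.congr_fun h m
  apply single_ext
  intro s v
  rw [LinearMap.comp_apply, LinearMap.comp_apply, T.E_X_self, Module.End.mul_apply, TM.ext,
    exm_single, ← Module.End.mul_apply Y, ← pow_succ']
  by_cases h : s.val + 1 < a i
  · rw [sh_single s.val h, sl_single, exm_single]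
    dsimp only
    rw [← Module.End.mul_apply (_ ^ (s.val + 1)), pow_succ (↑(T.Θ i)⁻¹ : Module.End k T.V) s.val, mul_assoc,
      Units.inv_mul, mul_one]
  · rw [sh_last s h, map_zero, map_zero, show s.val + 1 = a i by omega, hY, LinearMap.zero_apply]

lemma TM.ext_ne (T : TM k c q a) {i l : Fin c} (hl : l ≠ i) {P : Type} [AddCommGroup P] [Module k P]
    (Y : Module.End k P) (Z : Module.End k P) (hYZ : Y * Z = q i l • (Z * Y)) (g : T.V →ₗ[k] P)
    (hg : It (T.X l) Z g) :
    It ((T.E hqd hqc i).X l) Z (T.ext hqd hqc i Y g) := by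
  intro m
  suffices h : T.ext hqd hqc i Y g ∘ₗ (T.E hqd hqc i).X l = Z ∘ₗ T.ext hqd hqc i Y g from
    LinearMap.congr_fun h m
  apply single_ext
  intro s v
  rw [LinearMap.comp_apply, LinearMap.comp_apply, T.E_X_ne _ _ hl, TM.ext, sl_single,
    exm_single, exm_single, ← Module.End.mul_apply (_ ^ _), qpow (T.ΘiX hqc i l), LinearMap.smul_apply,
    Module.End.mul_apply, map_smul, map_smul, hg, ← Module.End.mul_apply (_ ^ _), qpow hYZ,
    LinearMap.smul_apply, smul_smul, ← mul_pow, hqc, one_pow, one_smul, Module.End.mul_apply]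

lemma TM.ext_uniq (T : TM k c q a) (i : Fin c) {P : Type} [AddCommGroup P] [Module k P]
    (Y : Module.End k P) {f g : (T.E hqd hqc i).V →ₗ[k] P} (hf : It ((T.E hqd hqc i).X i) Y f)
    (hg : It ((T.E hqd hqc i).X i) Y g) 
    (h : f ∘ₗ T.s0 hqd hqc ha i = g ∘ₗ T.s0 hqd hqc ha i) : f = g := by
  apply single_ext
  rintro ⟨s, hs⟩
  induction s with
  | zero => intro v; exact LinearMap.congr_fun h v
  | succ s ih =>
    intro v
    have key : (Pi.single ⟨s+1, hs⟩ v : Fin (a i) → T.V) =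
        (T.E hqd hqc i).X i (Pi.single ⟨s, by omega⟩ ((↑(T.Θ i)⁻¹ : Module.End k T.V) v)) := by
      rw [T.E_X_self, Module.End.mul_apply, sh_single s hs, sl_single, ← Module.End.mul_apply,
        Units.mul_inv, Module.End.one_apply]
    rw [key, hf, hg, ih]

lemma TM.s0_It (T : TM k c q a) {i l : Fin c} (hl : l ≠ i) {P : Type} [AddCommGroup P] [Module k P]
    (Y : Module.End k P) (f : (T.E hqd hqc i).V →ₗ[k] P) (hf : It ((T.E hqd hqc i).X l) Y f) :
    It (T.X l) Y (f ∘ₗ T.s0 hqd hqc ha i) := by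
  intro v
  rw [LinearMap.comp_apply, LinearMap.comp_apply, ← hf, T.E_X_ne _ _ hl, T.s0_apply, T.s0_apply,
    sl_single]

/-- relative projectivity -/
def RProj (j : ℕ) (M : TM k c q a) : Prop :=
  ∀ (P Q : Type) [AddCommGroup P] [Module k P] [AddCommGroup Q] [Module k Q]
    (YP : Fin c → Module.End k P) (YQ : Fin c → Module.End k Q), IsRep q a YP → IsRep q a YQ →
    ∀ p : P →ₗ[k] Q, Function.Surjective p → (∀ l, It (YP l) (YQ l) p) →
    ∀ g : M.V →ₗ[k] Q, (∀ l : Fin c, j ≤ l.val → It (M.X l) (YQ l) g) →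
    ∃ h : M.V →ₗ[k] P, (∀ l : Fin c, j ≤ l.val → It (M.X l) (YP l) h) ∧ p ∘ₗ h = g

lemma rproj_c (M : TM k c q a) : RProj c M := by
  intro P Q _ _ _ _ YP YQ hP hQ p hp hpl g hg
  obtain ⟨h, hh⟩ := Module.projective_lifting_property p g hp
  exact ⟨h, fun l hl => absurd l.2 (by omega), hh⟩

include ha in
lemma rproj_step (M : TM k c q a) (j : Fin c) (h : RProj (j.val + 1) M) :
    RProj j.val (M.E hqd hqc j) := by
  intro P Q _ _ _ _ YP YQ hP hQ p hp hpl g hg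
  obtain ⟨h0, h1, h2⟩ := h P Q YP YQ hP hQ p hp hpl (g ∘ₗ M.s0 hqd hqc ha j)
    (fun l hl => M.s0_It hqd hqc ha (by intro e; subst e; omega) _ g (hg l (by omega)))
  have hself := M.ext_self hqd hqc j (YP j) (hP.pow j) h0
  refine ⟨M.ext hqd hqc j (YP j) h0, fun l hl => ?_, ?_⟩
  · by_cases e : l = j
    · subst e; exact hself
    · exact M.ext_ne hqd hqc e _ _ (hP.comm j l) h0 (h1 l (by
        have : l.val ≠ j.val := fun h => e (Fin.ext h)
        omega))
  · refine M.ext_uniq hqd hqc ha j (YQ j) (fun m => ?_) (hg j le_rfl) ?_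
    · rw [LinearMap.comp_apply, LinearMap.comp_apply, hself, hpl]
    · rw [LinearMap.comp_assoc, M.ext_s0, h2]

lemma rproj_zero (M : TM k c q a) (h : RProj 0 M) : Module.Projective (QCI k c q a) M.Mod := by
  refine Module.Projective.of_lifting_property'' (fun p hp => ?_)
  obtain ⟨g, h1, h2⟩ := h (M.Mod →₀ QCI k c q a) M.Mod (opN q a _) (opN q a _) (opN_rep _) (opN_rep _)
    (p.restrictScalars k) hp (fun l x => by
      exact p.map_smul _ _) LinearMap.id (fun l _ x => by rw [M.opN_eq]; rfl)
  have h3 : ∀ i (x : M.Mod), (g : M.Mod →ₗ[k] _) (opN q a M.Mod i x) = opN q a _ i (g x) := by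
    intro i x
    rw [M.opN_eq]
    exact h1 i (Nat.zero_le _) x
  refine ⟨mkLin (P := M.Mod) (Q := M.Mod →₀ QCI k c q a) g h3, LinearMap.ext fun x => ?_⟩
  exact LinearMap.congr_fun h2 x
end UU

open CategoryTheory DirectSum

section AbsQ
variable {k : Type} [Field k] {c : ℕ} 
  {H : Type} [AddCommGroup H] [Module k H]

/-- quantum system of pairs of operators -/
structure QS (q : Fin c → Fin c → k) (a : Fin c → ℕ) (L R : Fin c → Module.End k H) : Prop where
  LL : ∀ i j, L i * L j = q i j • (L j * L i)
  LR : ∀ i j, L i * R j = q i j • (R j * L i)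
  RL : ∀ i j, R i * L j = q i j • (L j * R i)
  RR : ∀ i j, R i * R j = q i j • (R j * R i)
  Lp : ∀ i, L i ^ a i = 0
  Rp : ∀ i, R i ^ a i = 0

/-- the norm element -/
def nrm (n : ℕ) (L R : Module.End k H) : Module.End k H :=
  ∑ s ∈ Finset.range n, L ^ s * R ^ (n - 1 - s)

variable {q : Fin c → Fin c → k} {a : Fin c → ℕ} {L R : Fin c → Module.End k H}

lemma QS.DD (h : QS q a L R) (i j : Fin c) :
    (L i - R i) * (L j - R j) = q i j • ((L j - R j) * (L i - R i)) := by
  simp only [mul_sub, sub_mul, h.LL i j, h.LR i j, h.RL i j, h.RR i j, smul_sub]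
  abel

lemma nrm_qcomm {B L R : Module.End k H} {r : k} (hL : L * B = r • (B * L))
    (hR : R * B = r • (B * R)) (n : ℕ) : nrm n L R * B = r ^ (n - 1) • (B * nrm n L R) := by
  rw [nrm, Finset.sum_mul, Finset.mul_sum, Finset.smul_sum]
  refine Finset.sum_congr rfl fun s hs => ?_
  rw [mul_assoc, qpow hR, mul_smul_comm, ← mul_assoc, qpow hL, smul_mul_assoc, smul_smul, mul_assoc,
    ← pow_add]
  congr 2
  have := Finset.mem_range.1 hs
  omega

lemma QS.TD (h : QS q a L R) (i j : Fin c) :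
    nrm (a i) (L i) (R i) * (L j - R j) = q i j ^ (a i - 1) • ((L j - R j) * nrm (a i) (L i) (R i)) := by
  apply nrm_qcomm
  · simp only [mul_sub, sub_mul, h.LL i j, h.LR i j, smul_sub]
  · simp only [mul_sub, sub_mul, h.RL i j, h.RR i j, smul_sub]

lemma qswap {A B : Module.End k H} {r s : k} (hrs : r * s = 1) (h : A * B = r • (B * A)) :
    B * A = s • (A * B) := by
  rw [h, smul_smul, mul_comm s, hrs, one_smul]

lemma nrm_qcomm' {B L R : Module.End k H} {r s : k} (hrs : r * s = 1) (hL : B * L = r • (L * B))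
    (hR : B * R = r • (R * B)) (n : ℕ) : B * nrm n L R = r ^ (n - 1) • (nrm n L R * B) :=
  qswap (r := s ^ (n-1)) (by rw [← mul_pow, mul_comm, hrs, one_pow])
    (nrm_qcomm (qswap hrs hL) (qswap hrs hR) n)

lemma QS.TT (hqc : ∀ i j, q i j * q j i = 1) (h : QS q a L R) (i j : Fin c) :
    nrm (a i) (L i) (R i) * nrm (a j) (L j) (R j) =
      q i j ^ ((a j - 1) * (a i - 1)) • (nrm (a j) (L j) (R j) * nrm (a i) (L i) (R i)) := by
  rw [pow_mul]
  apply nrm_qcomm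
  · exact nrm_qcomm' (hqc i j) (h.LL i j) (h.LR i j) _
  · exact nrm_qcomm' (hqc i j) (h.RL i j) (h.RR i j) _

lemma QS.Dnrm (hqd : ∀ i, q i i = 1) (h : QS q a L R) (i : Fin c) :
    (L i - R i) * nrm (a i) (L i) (R i) = 0 := by
  have hc : Commute (L i) (R i) := by
    have := h.LR i i
    rwa [hqd, one_smul] at this
  rw [nrm, hc.mul_geom_sum₂, h.Lp, h.Rp, sub_zero]

lemma QS.nrmD (hqd : ∀ i, q i i = 1) (h : QS q a L R) (i : Fin c) :
    nrm (a i) (L i) (R i) * (L i - R i) = 0 := by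
  rw [h.TD, hqd, one_pow, one_smul, h.Dnrm hqd]

end AbsQ

section HH
variable {k : Type} [Field k] {c : ℕ} {q : Fin c → Fin c → k} {a : Fin c → ℕ}
  (hqd : ∀ i, q i i = 1) (hqc : ∀ i j, q i j * q j i = 1) (ha : ∀ i, 2 ≤ a i)

/-- left operator -/
def Lop (M N : TM k c q a) (i : Fin c) : Module.End k (M.V →ₗ[k] N.V) where
  toFun g := N.X i ∘ₗ g ∘ₗ (↑(M.Θ i)⁻¹ : Module.End k M.V)
  map_add' f g := by ext; simp
  map_smul' f g := by ext; simp

/-- right operator -/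
def Rop (M N : TM k c q a) (i : Fin c) : Module.End k (M.V →ₗ[k] N.V) where
  toFun g := g ∘ₗ M.y i
  map_add' f g := by ext; simp
  map_smul' f g := by ext; simp

lemma Lop_apply (M N : TM k c q a) (i : Fin c) (g : M.V →ₗ[k] N.V) (m : M.V) :
    Lop M N i g m = N.X i (g ((↑(M.Θ i)⁻¹ : Module.End k M.V) m)) := rfl
lemma Rop_apply (M N : TM k c q a) (i : Fin c) (g : M.V →ₗ[k] N.V) (m : M.V) :
    Rop M N i g m = g (M.y i m) := rfl

lemma Lop_pow (M N : TM k c q a) (i : Fin c) (g : M.V →ₗ[k] N.V) (s : ℕ) (m : M.V) :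
    (Lop M N i ^ s) g m = (N.X i ^ s) (g (((↑(M.Θ i)⁻¹ : Module.End k M.V) ^ s) m)) := by
  induction s generalizing m with
  | zero => rfl
  | succ s ih =>
    rw [pow_succ', Module.End.mul_apply, Lop_apply, ih, pow_succ' (N.X i), Module.End.mul_apply,
      pow_succ _ s, Module.End.mul_apply]

lemma Rop_pow (M N : TM k c q a) (i : Fin c) (g : M.V →ₗ[k] N.V) (s : ℕ) (m : M.V) :
    (Rop M N i ^ s) g m = g ((M.y i ^ s) m) := by
  induction s generalizing m with
  | zero => rfl
  | succ s ih =>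
    rw [pow_succ', Module.End.mul_apply, Rop_apply, ih, pow_succ _ s, Module.End.mul_apply]

/-- D -/
def Dop (M N : TM k c q a) (i : Fin c) : Module.End k (M.V →ₗ[k] N.V) := Lop M N i - Rop M N i
/-- T -/
def Top' (M N : TM k c q a) (i : Fin c) : Module.End k (M.V →ₗ[k] N.V) :=
  nrm (a i) (Lop M N i) (Rop M N i)

lemma ΘiΘi (M : TM k c q a) (i j : Fin c) :
    (↑(M.Θ i)⁻¹ : Module.End k M.V) * ↑(M.Θ j)⁻¹ = ↑(M.Θ j)⁻¹ * ↑(M.Θ i)⁻¹ := by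
  have := (M.Θcomm i j).inv_inv
  exact congrArg Units.val this.eq

include hqc in
lemma Θi_y (M : TM k c q a) (i j : Fin c) :
    (↑(M.Θ i)⁻¹ : Module.End k M.V) * M.y j = q j i • (M.y j * ↑(M.Θ i)⁻¹) := by
  rw [TM.y, ← mul_assoc, M.ΘiX hqc, smul_mul_assoc, mul_assoc, ΘiΘi, mul_assoc]

include hqc in
lemma y_y (M : TM k c q a) (i j : Fin c) :
    M.y j * M.y i = q i j • (M.y i * M.y j) := by
  conv_lhs => rw [TM.y.eq_1 M i, ← mul_assoc, (M.y_X hqc j i).eq, mul_assoc]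
  rw [TM.y.eq_1 M i, mul_assoc, Θi_y hqc, mul_smul_comm, smul_smul, hqc, one_smul]

include hqd hqc in
lemma hom_QS (M N : TM k c q a) : QS q a (Lop M N) (Rop M N) where
  LL i j := by
    refine LinearMap.ext fun g => LinearMap.ext fun m => ?_
    simp only [Module.End.mul_apply, LinearMap.smul_apply, Lop_apply]
    rw [← Module.End.mul_apply (N.X i), N.rep.comm, ← Module.End.mul_apply (M.Θ j)⁻¹.val, ΘiΘi]
    rfl
  LR i j := by
    refine LinearMap.ext fun g => LinearMap.ext fun m => ?_
    simp only [Module.End.mul_apply, LinearMap.smul_apply, Lop_apply, Rop_apply]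
    rw [← Module.End.mul_apply (M.Θ i)⁻¹.val, Θi_y hqc, LinearMap.smul_apply, map_smul, map_smul,
      smul_smul, hqc, one_smul]
    rfl
  RL i j := by
    refine LinearMap.ext fun g => LinearMap.ext fun m => ?_
    simp only [Module.End.mul_apply, LinearMap.smul_apply, Lop_apply, Rop_apply]
    rw [← Module.End.mul_apply (M.Θ j)⁻¹.val, Θi_y hqc, LinearMap.smul_apply, map_smul, map_smul]
    rfl
  RR i j := by
    refine LinearMap.ext fun g => LinearMap.ext fun m => ?_
    simp only [Module.End.mul_apply, LinearMap.smul_apply, Rop_apply]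
    rw [← Module.End.mul_apply (M.y j), y_y hqc, LinearMap.smul_apply, map_smul]
    rfl
  Lp i := by
    refine LinearMap.ext fun g => LinearMap.ext fun m => ?_
    rw [Lop_pow, N.rep.pow]; rfl
  Rp i := by
    refine LinearMap.ext fun g => LinearMap.ext fun m => ?_
    rw [Rop_pow, M.y_pow hqd hqc]; simp

lemma Dop_zero (M N : TM k c q a) (i : Fin c) (g : M.V →ₗ[k] N.V) :
    Dop M N i g = 0 ↔ Cm M N i g := by
  constructor
  · intro h m
    have := LinearMap.congr_fun h ((M.Θ i : Module.End k M.V) m)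
    rw [Dop, LinearMap.sub_apply, LinearMap.sub_apply, Lop_apply, Rop_apply, TM.y,
      ← Module.End.mul_apply (M.Θ i)⁻¹.val, Units.inv_mul, ← Module.End.mul_apply (M.X i * _),
      mul_assoc, Units.inv_mul, mul_one] at this
    exact (sub_eq_zero.1 this).symm
  · intro h
    refine LinearMap.ext fun m => ?_
    rw [Dop, LinearMap.sub_apply, LinearMap.sub_apply, Lop_apply, Rop_apply, ← h]
    exact sub_self _

/-- exactness in direction `i` on maps commuting with `S` -/
def EX (S : Fin c → Prop) (i : Fin c) (M N : TM k c q a) : Prop :=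
  ∀ g : M.V →ₗ[k] N.V, (∀ l, S l → Dop M N l g = 0) →
    (Dop M N i g = 0 → ∃ h, (∀ l, S l → Dop M N l h = 0) ∧ Top' M N i h = g) ∧
    (Top' M N i g = 0 → ∃ h, (∀ l, S l → Dop M N l h = 0) ∧ Dop M N i h = g)

include hqc hqd in
lemma Dop_D (M N : TM k c q a) (i l : Fin c) {g : M.V →ₗ[k] N.V} (h : Dop M N l g = 0) :
    Dop M N l (Dop M N i g) = 0 := by
  have := LinearMap.congr_fun ((hom_QS hqd hqc M N).DD l i) g
  change Dop M N l (Dop M N i g) = q l i • (Dop M N i (Dop M N l g)) at this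
  rw [this, h, map_zero, smul_zero]

include hqc hqd in
lemma Dop_T (M N : TM k c q a) (i l : Fin c) {g : M.V →ₗ[k] N.V} (h : Dop M N l g = 0) :
    Dop M N l (Top' M N i g) = 0 := by
  have := LinearMap.congr_fun (qswap (s := q l i ^ (a i - 1)) (by rw [← mul_pow, hqc, one_pow])
    ((hom_QS hqd hqc M N).TD i l)) g
  change Dop M N l (Top' M N i g) = q l i ^ (a i - 1) • (Top' M N i (Dop M N l g)) at this
  rw [this, h, map_zero, smul_zero]

/-- restriction to slot zero -/
def res (M N : TM k c q a) (j : Fin c) :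
    ((M.E hqd hqc j).V →ₗ[k] N.V) →ₗ[k] (M.V →ₗ[k] N.V) :=
  LinearMap.lcomp k N.V (M.s0 hqd hqc ha j)

lemma res_apply (M N : TM k c q a) (j : Fin c) (f : (M.E hqd hqc j).V →ₗ[k] N.V) (m : M.V) :
    res hqd hqc ha M N j f m = f (M.s0 hqd hqc ha j m) := rfl

lemma EΘi_s0 (M : TM k c q a) (i j : Fin c) (m : M.V) :
    ((M.E hqd hqc j).Θ i)⁻¹.val (M.s0 hqd hqc ha j m) = M.s0 hqd hqc ha j ((M.Θ i)⁻¹.val m) := by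
  change (sl (a j) ((M.Θ i)⁻¹.val) * dg M.V (a j) (q j i)) (Pi.single _ m) = _
  rw [Module.End.mul_apply, dg_single]
  dsimp only
  rw [pow_zero, one_smul, sl_single]
  rfl

lemma res_L (M N : TM k c q a) (i j : Fin c) :
    res hqd hqc ha M N j ∘ₗ Lop (M.E hqd hqc j) N i = Lop M N i ∘ₗ res hqd hqc ha M N j := by
  refine LinearMap.ext fun g => LinearMap.ext fun m => ?_
  rw [LinearMap.comp_apply, LinearMap.comp_apply, res_apply, Lop_apply, Lop_apply, res_apply, EΘi_s0]

lemma res_R (M N : TM k c q a) {i j : Fin c} (hij : i ≠ j) :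
    res hqd hqc ha M N j ∘ₗ Rop (M.E hqd hqc j) N i = Rop M N i ∘ₗ res hqd hqc ha M N j := by
  refine LinearMap.ext fun g => LinearMap.ext fun m => ?_
  rw [LinearMap.comp_apply, LinearMap.comp_apply, res_apply, Rop_apply, Rop_apply, res_apply, TM.y,
    Module.End.mul_apply, EΘi_s0, M.E_X_ne _ _ hij, TM.s0_apply, sl_single, TM.y]
  rfl

lemma semi_pow {H H' : Type} [AddCommGroup H] [Module k H] [AddCommGroup H'] [Module k H']
    {r : H →ₗ[k] H'} {A : Module.End k H} {B : Module.End k H'} (h : r ∘ₗ A = B ∘ₗ r) (s : ℕ) :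
    r ∘ₗ (A ^ s) = (B ^ s) ∘ₗ r := by
  induction s with
  | zero => rfl
  | succ s ih =>
    rw [pow_succ, pow_succ, Module.End.mul_eq_comp, Module.End.mul_eq_comp, ← LinearMap.comp_assoc, ih,
      LinearMap.comp_assoc, h, LinearMap.comp_assoc]

lemma semi_nrm {H H' : Type} [AddCommGroup H] [Module k H] [AddCommGroup H'] [Module k H']
    {r : H →ₗ[k] H'} {A C : Module.End k H} {B D : Module.End k H'} (h : r ∘ₗ A = B ∘ₗ r)
    (h' : r ∘ₗ C = D ∘ₗ r) (n : ℕ) (x : H) :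
    r (nrm n A C x) = nrm n B D (r x) := by
  rw [nrm, nrm, LinearMap.sum_apply, LinearMap.sum_apply, map_sum]
  refine Finset.sum_congr rfl fun s _ => ?_
  rw [Module.End.mul_apply, Module.End.mul_apply]
  have h1 := LinearMap.congr_fun (semi_pow h s) ((C ^ (n-1-s)) x)
  have h2 := LinearMap.congr_fun (semi_pow h' (n-1-s)) x
  simp only [LinearMap.comp_apply] at h1 h2
  rw [h1, h2]

lemma res_D (M N : TM k c q a) {i j : Fin c} (hij : i ≠ j) (f) :
    res hqd hqc ha M N j (Dop (M.E hqd hqc j) N i f) = Dop M N i (res hqd hqc ha M N j f) := by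
  have h1 := LinearMap.congr_fun (res_L hqd hqc ha M N i j) f
  have h2 := LinearMap.congr_fun (res_R hqd hqc ha M N hij) f
  simp only [LinearMap.comp_apply] at h1 h2
  rw [Dop, Dop, LinearMap.sub_apply, LinearMap.sub_apply, map_sub, h1, h2]

lemma res_T (M N : TM k c q a) {i j : Fin c} (hij : i ≠ j) (f) :
    res hqd hqc ha M N j (Top' (M.E hqd hqc j) N i f) = Top' M N i (res hqd hqc ha M N j f) :=
  semi_nrm (res_L hqd hqc ha M N i j) (res_R hqd hqc ha M N hij) _ f

lemma res_inj (M N : TM k c q a) {j : Fin c} {f f' : (M.E hqd hqc j).V →ₗ[k] N.V}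
    (hf : Dop (M.E hqd hqc j) N j f = 0) (hf' : Dop (M.E hqd hqc j) N j f' = 0)
    (h : res hqd hqc ha M N j f = res hqd hqc ha M N j f') : f = f' :=
  M.ext_uniq hqd hqc ha j (N.X j) ((Dop_zero _ _ _ _).1 hf) ((Dop_zero _ _ _ _).1 hf') h

lemma res_lift (M N : TM k c q a) {j : Fin c} (S : Fin c → Prop) (hS : ¬ S j) {g : M.V →ₗ[k] N.V}
    (hg : ∀ l, S l → Dop M N l g = 0) : ∃ f : (M.E hqd hqc j).V →ₗ[k] N.V,
      (∀ l, (S l ∨ l = j) → Dop (M.E hqd hqc j) N l f = 0) ∧ res hqd hqc ha M N j f = g := by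
  refine ⟨M.ext hqd hqc j (N.X j) g, ?_, M.ext_s0 hqd hqc ha j _ g⟩
  rintro l hl
  rw [Dop_zero]
  by_cases e : l = j
  · subst e
    exact M.ext_self hqd hqc l (N.X l) (N.rep.pow l) g
  · exact M.ext_ne hqd hqc e _ _ (N.rep.comm j l) g
      ((Dop_zero _ _ _ _).1 (hg l (hl.resolve_right e)))

lemma res_d (M N : TM k c q a) {j : Fin c} {f : (M.E hqd hqc j).V →ₗ[k] N.V}
    (hf : Dop (M.E hqd hqc j) N j f = 0) :
    res hqd hqc ha M N j (f ∘ₗ M.d hqd hqc j) = Dop M N j (res hqd hqc ha M N j f) := by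
  have hf1 := (Dop_zero _ _ _ _).1 hf
  refine LinearMap.ext fun m => ?_
  have h1 : M.d hqd hqc j (M.s0 hqd hqc ha j m) =
      (M.E hqd hqc j).X j (M.s0 hqd hqc ha j ((M.Θ j)⁻¹.val m)) - M.s0 hqd hqc ha j (M.y j m) := by
    rw [TM.d, LinearMap.sub_apply, M.E_X_self, Module.End.mul_apply, TM.s0_apply, TM.s0_apply,
      TM.s0_apply, sl_single, sh_single 0 (by have := ha j; omega),
      sh_single 0 (by have := ha j; omega), sl_single, ← Module.End.mul_apply, Units.mul_inv]
    rfl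
  rw [res_apply, LinearMap.comp_apply, h1, map_sub, hf1, Dop, LinearMap.sub_apply,
    LinearMap.sub_apply, Lop_apply, Rop_apply, res_apply, res_apply]

lemma res_ιπ (M N : TM k c q a) {j : Fin c} {f : (M.E hqd hqc j).V →ₗ[k] N.V}
    (hf : Dop (M.E hqd hqc j) N j f = 0) :
    res hqd hqc ha M N j (f ∘ₗ M.ι hqd hqc j ∘ₗ M.π hqd hqc j) =
      Top' M N j (res hqd hqc ha M N j f) := by
  have hf1 : f = M.ext hqd hqc j (N.X j) (res hqd hqc ha M N j f) := 
    M.ext_uniq hqd hqc ha j (N.X j) ((Dop_zero _ _ _ _).1 hf)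
      (M.ext_self hqd hqc j (N.X j) (N.rep.pow j) _) (M.ext_s0 hqd hqc ha j _ _).symm
  refine LinearMap.ext fun m => ?_
  have h1 : M.π hqd hqc j (M.s0 hqd hqc ha j m) = m := by
    rw [TM.π, TM.s0_apply, exm_single]; simp
  rw [res_apply, LinearMap.comp_apply, LinearMap.comp_apply, h1]
  generalize res hqd hqc ha M N j f = g at hf1
  subst hf1
  rw [TM.ι, iot_eq_sum, map_sum, Top', nrm, LinearMap.sum_apply, LinearMap.sum_apply,
    Finset.sum_range]
  refine Finset.sum_congr rfl fun s _ => ?_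
  rw [Module.End.mul_apply, Lop_pow, Rop_pow, TM.ext, exm_single]
  congr 2
  have : Commute (M.y j) (M.Θ j)⁻¹.val := (M.y_Θ hqd j).units_inv_right
  exact LinearMap.congr_fun ((this.pow_pow _ _).symm).eq m
end HH

open CategoryTheory DirectSum

section TA
variable {k : Type} [Field k] {c : ℕ} {q : Fin c → Fin c → k} {a : Fin c → ℕ}
  (hqd : ∀ i, q i i = 1) (hqc : ∀ i j, q i j * q j i = 1) (ha : ∀ i, 2 ≤ a i)

include ha in
lemma EX_E (M N : TM k c q a) {i j : Fin c} (hij : i ≠ j) (S : Fin c → Prop) (hS : ¬ S j) :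
    EX S i M N ↔ EX (fun l => S l ∨ l = j) i (M.E hqd hqc j) N := by
  have hne : ∀ l, S l → l ≠ j := fun l hl e => hS (e ▸ hl)
  constructor
  · intro h f hf
    obtain ⟨h1, h2⟩ := h (res hqd hqc ha M N j f) (fun l hl => by
      rw [← res_D hqd hqc ha M N (hne l hl), hf l (Or.inl hl), map_zero])
    constructor
    · intro hD
      obtain ⟨g, hg1, hg2⟩ := h1 (by rw [← res_D hqd hqc ha M N hij, hD, map_zero])
      obtain ⟨f', hf'1, hf'2⟩ := res_lift hqd hqc ha M N S hS hg1
      refine ⟨f', hf'1, res_inj hqd hqc ha M N (Dop_T hqd hqc _ _ _ _ (hf'1 j (Or.inr rfl)))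
        (hf j (Or.inr rfl)) ?_⟩
      rw [res_T hqd hqc ha M N hij, hf'2, hg2]
    · intro hD
      obtain ⟨g, hg1, hg2⟩ := h2 (by rw [← res_T hqd hqc ha M N hij, hD, map_zero])
      obtain ⟨f', hf'1, hf'2⟩ := res_lift hqd hqc ha M N S hS hg1
      refine ⟨f', hf'1, res_inj hqd hqc ha M N (Dop_D hqd hqc _ _ _ _ (hf'1 j (Or.inr rfl)))
        (hf j (Or.inr rfl)) ?_⟩
      rw [res_D hqd hqc ha M N hij, hf'2, hg2]
  · intro h g hg
    obtain ⟨f, hf1, rfl⟩ := res_lift hqd hqc ha M N S hS hg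
    obtain ⟨h1, h2⟩ := h f hf1
    constructor
    · intro hD
      obtain ⟨f', hf'1, hf'2⟩ := h1 (res_inj hqd hqc ha M N 
        (Dop_D hqd hqc _ _ _ _ (hf1 j (Or.inr rfl))) (map_zero _) (by
          rw [res_D hqd hqc ha M N hij, hD, map_zero]))
      refine ⟨res hqd hqc ha M N j f', fun l hl => ?_, ?_⟩
      · rw [← res_D hqd hqc ha M N (hne l hl), hf'1 l (Or.inl hl), map_zero]
      · rw [← res_T hqd hqc ha M N hij, hf'2]
    · intro hD
      obtain ⟨f', hf'1, hf'2⟩ := h2 (res_inj hqd hqc ha M N 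
        (Dop_T hqd hqc _ _ _ _ (hf1 j (Or.inr rfl))) (map_zero _) (by
          rw [res_T hqd hqc ha M N hij, hD, map_zero]))
      refine ⟨res hqd hqc ha M N j f', fun l hl => ?_, ?_⟩
      · rw [← res_D hqd hqc ha M N (hne l hl), hf'1 l (Or.inl hl), map_zero]
      · rw [← res_D hqd hqc ha M N hij, hf'2]

def EXA (M N : TM k c q a) (j : Fin c) : Prop :=
  (∀ f : (M.E hqd hqc j).Mod →ₗ[QCI k c q a] N.Mod, f ∘ₗ (mkTM (M.d hqd hqc j) (M.d_Cm hqd hqc j)) = 0 →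
    ∃ h : (M.E hqd hqc j).Mod →ₗ[QCI k c q a] N.Mod, h ∘ₗ mkTM (M.ι hqd hqc j) (M.ι_Cm hqd hqc j) ∘ₗ
      mkTM (M.π hqd hqc j) (M.π_Cm hqd hqc j) = f) ∧
  (∀ f : (M.E hqd hqc j).Mod →ₗ[QCI k c q a] N.Mod, f ∘ₗ mkTM (M.ι hqd hqc j) (M.ι_Cm hqd hqc j) ∘ₗ
      mkTM (M.π hqd hqc j) (M.π_Cm hqd hqc j) = 0 →
    ∃ h : (M.E hqd hqc j).Mod →ₗ[QCI k c q a] N.Mod, h ∘ₗ (mkTM (M.d hqd hqc j) (M.d_Cm hqd hqc j)) = f)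

lemma unTM_mkTM {M N : TM k c q a} (g : M.V →ₗ[k] N.V) (h : ∀ l, Cm M N l g) :
    unTM (mkTM g h) = g := rfl

lemma unTM_inj {M N : TM k c q a} {f g : M.Mod →ₗ[QCI k c q a] N.Mod} (h : unTM f = unTM g) :
    f = g := LinearMap.ext fun x => LinearMap.congr_fun h x

lemma unTM_comp {M N P : TM k c q a} (f : M.Mod →ₗ[QCI k c q a] N.Mod)
    (g : N.Mod →ₗ[QCI k c q a] P.Mod) : unTM (g ∘ₗ f) = unTM g ∘ₗ unTM f := rfl

lemma unTM_zero {M N : TM k c q a} : unTM (0 : M.Mod →ₗ[QCI k c q a] N.Mod) = 0 := rfl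

lemma unTM_D {M N : TM k c q a} (f : M.Mod →ₗ[QCI k c q a] N.Mod) (l : Fin c) :
    Dop M N l (unTM f) = 0 := (Dop_zero _ _ _ _).2 (unTM_Cm f l)

include ha in
lemma EX_A (M N : TM k c q a) (j : Fin c) :
    EX (fun l => l ≠ j) j M N ↔ EXA hqd hqc M N j := by
  have rd : ∀ f : (M.E hqd hqc j).Mod →ₗ[QCI k c q a] N.Mod,
    res hqd hqc ha M N j (unTM (f ∘ₗ (mkTM (M.d hqd hqc j) (M.d_Cm hqd hqc j)))) =
      Dop M N j (res hqd hqc ha M N j (unTM f)) := fun f => res_d hqd hqc ha M N (unTM_D f j)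
  have rt : ∀ f : (M.E hqd hqc j).Mod →ₗ[QCI k c q a] N.Mod,
    res hqd hqc ha M N j (unTM (f ∘ₗ mkTM (M.ι hqd hqc j) (M.ι_Cm hqd hqc j) ∘ₗ
      mkTM (M.π hqd hqc j) (M.π_Cm hqd hqc j))) =
      Top' M N j (res hqd hqc ha M N j (unTM f)) := fun f => res_ιπ hqd hqc ha M N (unTM_D f j)
  have inj : ∀ f g : (M.E hqd hqc j).Mod →ₗ[QCI k c q a] N.Mod,
      res hqd hqc ha M N j (unTM f) = res hqd hqc ha M N j (unTM g) → f = g := fun f g h =>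
    unTM_inj (res_inj hqd hqc ha M N (unTM_D f j) (unTM_D g j) h)
  have comm : ∀ f : (M.E hqd hqc j).Mod →ₗ[QCI k c q a] N.Mod, ∀ l, l ≠ j →
      Dop M N l (res hqd hqc ha M N j (unTM f)) = 0 := fun f l hl => by
    rw [← res_D hqd hqc ha M N hl, unTM_D, map_zero]
  have lift : ∀ g : M.V →ₗ[k] N.V, (∀ l, l ≠ j → Dop M N l g = 0) →
      ∃ f : (M.E hqd hqc j).Mod →ₗ[QCI k c q a] N.Mod, res hqd hqc ha M N j (unTM f) = g := by
    intro g hg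
    obtain ⟨f, h1, h2⟩ := res_lift hqd hqc ha M N (j := j) (fun l => l ≠ j) (by simp) hg
    exact ⟨mkTM f (fun l => (Dop_zero _ _ _ _).1 (h1 l (by tauto))), h2⟩
  have r0 : res hqd hqc ha M N j (unTM (0 : (M.E hqd hqc j).Mod →ₗ[QCI k c q a] N.Mod)) = 0 := rfl
  constructor
  · intro h
    constructor
    · intro f hf
      obtain ⟨g, hg1, hg2⟩ := (h _ (comm f)).1 (by rw [← rd, hf, r0])
      obtain ⟨f', rfl⟩ := lift g hg1
      exact ⟨f', inj _ _ (by rw [rt, hg2])⟩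
    · intro f hf
      obtain ⟨g, hg1, hg2⟩ := (h _ (comm f)).2 (by rw [← rt, hf, r0])
      obtain ⟨f', rfl⟩ := lift g hg1
      exact ⟨f', inj _ _ (by rw [rd, hg2])⟩
  · intro h g hg
    obtain ⟨f, rfl⟩ := lift g hg
    constructor
    · intro hD
      obtain ⟨f', hf'⟩ := h.1 f (inj _ _ (by rw [rd, hD, r0]))
      exact ⟨_, comm f', by rw [← rt, hf']⟩
    · intro hD
      obtain ⟨f', hf'⟩ := h.2 f (inj _ _ (by rw [rt, hD, r0]))
      exact ⟨_, comm f', by rw [← rd, hf']⟩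

def WW (j : ℕ) (M N : TM k c q a) : Prop :=
  ∀ i : Fin c, i.val < j → EX (fun l => l < i ∨ j ≤ l.val) i M N

include hqd hqc ha in
lemma WW_step (M N : TM k c q a) (j : Fin c) :
    WW (j.val + 1) M N ↔ WW j.val (M.E hqd hqc j) N ∧ EX (fun l => l ≠ j) j M N := by
  have h1 : (fun l : Fin c => l < j ∨ j.val + 1 ≤ l.val) = fun l => l ≠ j := by
    funext l
    simp only [Fin.lt_def, ne_eq, Fin.ext_iff, eq_iff_iff]
    omega
  have h2 : ∀ i : Fin c, i.val < j.val → (EX (fun l : Fin c => l < i ∨ j.val + 1 ≤ l.val) i M N ↔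
      EX (fun l : Fin c => l < i ∨ j.val ≤ l.val) i (M.E hqd hqc j) N) := by
    intro i hi
    rw [EX_E hqd hqc ha M N (j := j) (by intro e; subst e; omega) _ (by
      simp only [Fin.lt_def]; omega)]
    have : (fun l : Fin c => (l < i ∨ j.val + 1 ≤ l.val) ∨ l = j) = fun l => l < i ∨ j.val ≤ l.val := by
      funext l
      simp only [Fin.lt_def, Fin.ext_iff, eq_iff_iff]
      omega
    rw [this]
  constructor
  · intro h
    exact ⟨fun i hi => (h2 i hi).1 (h i (by omega)), h1 ▸ h j (by omega)⟩
  · rintro ⟨ha, hb⟩ i hi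
    by_cases e : i = j
    · subst e; rw [h1]; exact hb
    · have : i.val ≠ j.val := fun h => e (Fin.ext h)
      exact (h2 i (by omega)).2 (ha i (by omega))

include hqd hqc ha in
theorem thmA (N : TM k c q a) (j : ℕ) (hj : j ≤ c) : ∀ M : TM k c q a, RProj j M →
    ((∃ n₀, ∀ n ≥ n₀, Ev (QCI k c q a) M.Mod N.Mod n) → WW j M N) ∧
    (WW j M N → ∀ n, Ev (QCI k c q a) M.Mod N.Mod (n+1)) := by
  induction j with
  | zero =>
    intro M hM
    refine ⟨fun _ i hi => absurd hi (by omega), fun _ n => ?_⟩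
    have := rproj_zero M hM
    exact ev_of_lift n
  | succ j ih =>
    intro M hM
    obtain ⟨i1, i2⟩ := ih (by omega) (M.E hqd hqc ⟨j, hj⟩) (rproj_step hqd hqc ha M ⟨j, hj⟩ hM)
    have P := M.per hqd hqc ha ⟨j, hj⟩
    have hst := WW_step hqd hqc ha M N ⟨j, hj⟩
    dsimp only at hst
    constructor
    · rintro ⟨n₀, h⟩
      have hE := i1 ⟨n₀, P.ev_E h⟩
      have hE2 := i2 hE
      have hM2 := P.all hE2 h
      rw [hst]
      exact ⟨hE, (EX_A hqd hqc ha M N _).2 (P.exact_of_ev hE2 (hM2 0) (hM2 1))⟩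
    · intro h
      rw [hst] at h
      have hx := (EX_A hqd hqc ha M N _).1 h.2
      exact P.ev_of_exact (i2 h.1) hx.1 hx.2
end TA

open CategoryTheory DirectSum

section AbsB
variable {k : Type} [Field k] {c : ℕ} 
  {H : Type} [AddCommGroup H] [Module k H]

/-- quasi-commuting -/
def QC (A B : Module.End k H) : Prop := ∃ r : k, r ≠ 0 ∧ A * B = r • (B * A)

lemma QC.symm {A B : Module.End k H} (h : QC A B) : QC B A := by
  obtain ⟨r, hr, h⟩ := h
  exact ⟨r⁻¹, inv_ne_zero hr, by rw [h, smul_smul, inv_mul_cancel₀ hr, one_smul]⟩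

lemma QC.mul {A B C : Module.End k H} (h : QC A C) (h' : QC B C) : QC (A * B) C := by
  obtain ⟨r, hr, h⟩ := h
  obtain ⟨s, hs, h'⟩ := h'
  refine ⟨s * r, mul_ne_zero hs hr, ?_⟩
  rw [mul_assoc, h', mul_smul_comm, ← mul_assoc, h, smul_mul_assoc, smul_smul, mul_assoc]

lemma QC.one (A : Module.End k H) : QC 1 A := ⟨1, one_ne_zero, by simp⟩

lemma QC.pow {A B : Module.End k H} (h : QC A B) (n : ℕ) : QC (A ^ n) B := by
  induction n with
  | zero => rw [pow_zero]; exact QC.one B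
  | succ n ih => rw [pow_succ]; exact ih.mul h

lemma QC.zero_of {A B : Module.End k H} (h : QC A B) {x : H} (hx : B x = 0) : B (A x) = 0 := by
  obtain ⟨r, hr, h⟩ := h.symm
  rw [← Module.End.mul_apply, h, LinearMap.smul_apply, Module.End.mul_apply, hx, map_zero, smul_zero]

/-- quasi-commuting exact systems -/
structure QE (D T : Fin c → Module.End k H) : Prop where
  DD : ∀ i j, QC (D i) (D j)
  TD : ∀ i j, QC (T i) (D j)
  TT : ∀ i j, QC (T i) (T j)
  DT0 : ∀ i, D i * T i = 0
  TD0 : ∀ i, T i * D i = 0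

/-- kernel-side exactness -/
def VK (D T : Fin c → Module.End k H) : Prop :=
  ∀ i g, (∀ l < i, D l g = 0) →
    (D i g = 0 → ∃ h, (∀ l < i, D l h = 0) ∧ T i h = g) ∧
    (T i g = 0 → ∃ h, (∀ l < i, D l h = 0) ∧ D i h = g)

/-- sum of images -/
def II (D : Fin c → Module.End k H) (j : ℕ) : Submodule k H :=
  ⨆ l : {l : Fin c // l.val < j}, LinearMap.range (D l.1)

lemma II_zero (D : Fin c → Module.End k H) : II D 0 = ⊥ := by
  rw [II, iSup_eq_bot]
  rintro ⟨l, hl⟩; omega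

lemma D_mem_II (D : Fin c → Module.End k H) (l : Fin c) (j : ℕ) (h : l.val < j) (x : H) :
    D l x ∈ II D j :=
  (le_iSup (fun l : {l : Fin c // l.val < j} => LinearMap.range (D l.1)) ⟨l, h⟩) ⟨x, rfl⟩

lemma II_le (D : Fin c → Module.End k H) (j : ℕ) (S : Submodule k H)
    (h : ∀ l : Fin c, l.val < j → ∀ x, D l x ∈ S) : II D j ≤ S := by
  refine iSup_le ?_
  rintro ⟨l, hl⟩ _ ⟨x, rfl⟩
  exact h l hl x

lemma II_mono (D : Fin c → Module.End k H) {i j : ℕ} (h : i ≤ j) : II D i ≤ II D j :=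
  II_le D i _ fun l hl x => D_mem_II D l j (by omega) x

lemma tau_exists {D T : Fin c → Module.End k H} (hQ : QE D T) (hV : VK D T) (j : ℕ) (hj : j ≤ c) :
    ∃ τ : Module.End k H, (∀ x, ∀ l : Fin c, l.val < j → D l (τ x) = 0) ∧
      (∀ g, (∀ l : Fin c, l.val < j → D l g = 0) → ∃ x, τ x = g) ∧
      (∀ x, τ x = 0 ↔ x ∈ II D j) ∧ (∀ l, QC τ (D l)) ∧ (∀ l, QC τ (T l)) := by
  induction j with
  | zero =>
    refine ⟨1, by intro x l hl; omega, fun g _ => ⟨g, rfl⟩, fun x => ?_, fun l => QC.one _,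
      fun l => QC.one _⟩
    rw [II_zero, Submodule.mem_bot]; rfl
  | succ j ih =>
    obtain ⟨τ, h1, h2, h3, h4, h5⟩ := ih (by omega)
    let J : Fin c := ⟨j, hj⟩
    refine ⟨T J * τ, ?_, ?_, ?_, fun l => (hQ.TD _ _).mul (h4 l), fun l => (hQ.TT _ _).mul (h5 l)⟩
    · intro x l hl
      rw [Module.End.mul_apply]
      by_cases e : l = J
      · rw [e, ← Module.End.mul_apply, hQ.DT0]; rfl
      · have : l.val ≠ j := fun h => e (Fin.ext h)
        exact (hQ.TD J l).zero_of (h1 x l (by omega))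
    · intro g hg
      obtain ⟨h, hh, rfl⟩ := (hV J g (fun l hl => hg l (by
        have : l.val < j := hl
        omega))).1 (hg J (by simp [J]))
      obtain ⟨x, rfl⟩ := h2 h (fun l hl => hh l hl)
      exact ⟨x, rfl⟩
    · intro x
      constructor
      · intro hx
        obtain ⟨g, hg1, hg2⟩ := (hV J (τ x) (fun l hl => h1 x l hl)).2 hx
        obtain ⟨z, rfl⟩ := h2 g (fun l hl => hg1 l hl)
        obtain ⟨r, hr, e⟩ := (h4 J).symm
        have e2 : τ (x - r • D J z) = 0 := by
          have := LinearMap.congr_fun e z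
          rw [Module.End.mul_apply, hg2] at this
          rw [map_sub, this, map_smul]; simp
        have := (h3 _).1 e2
        have := Submodule.add_mem _ (II_mono D (Nat.le_succ j) this)
          (Submodule.smul_mem _ r (D_mem_II D J (j+1) (by simp [J]) z))
        simpa using this
      · intro hx
        suffices hs : II D (j+1) ≤ LinearMap.ker (T J * τ) from hs hx
        refine II_le D _ _ fun l hl x => ?_
        rw [LinearMap.mem_ker, Module.End.mul_apply]
        by_cases e : l = J
        · obtain ⟨r, hr, e2⟩ := (h4 J)
          have := LinearMap.congr_fun e2 x
          rw [Module.End.mul_apply] at this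
          rw [e, this, LinearMap.smul_apply, map_smul, Module.End.mul_apply, 
            ← Module.End.mul_apply (T J), hQ.TD0]; simp
        · have : l.val ≠ j := fun h => e (Fin.ext h)
          rw [(h3 _).2 (D_mem_II D l j (by omega) x), map_zero]

lemma VK_dualish {D T : Fin c → Module.End k H} (hQ : QE D T) (hV : VK D T) (i : Fin c) :
    (∀ h, D i h ∈ II D i.val → ∃ h', h - T i h' ∈ II D i.val) ∧
    (∀ h, T i h ∈ II D i.val → ∃ h', h - D i h' ∈ II D i.val) := by
  obtain ⟨τ, h1, h2, h3, h4, h5⟩ := tau_exists hQ hV i.val i.2.le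
  constructor
  · intro h hh
    obtain ⟨g, hg1, hg2⟩ := (hV i (τ h) (fun l hl => h1 h l hl)).1 (by
      obtain ⟨r, hr, e⟩ := (h4 i).symm
      rw [← Module.End.mul_apply, e, LinearMap.smul_apply, Module.End.mul_apply, (h3 _).2 hh, smul_zero])
    obtain ⟨z, rfl⟩ := h2 g (fun l hl => hg1 l hl)
    obtain ⟨r, hr, e⟩ := (h5 i).symm
    refine ⟨r • z, (h3 _).1 ?_⟩
    have := LinearMap.congr_fun e z
    rw [Module.End.mul_apply, hg2] at this
    rw [map_sub, this, map_smul, map_smul]; simp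
  · intro h hh
    obtain ⟨g, hg1, hg2⟩ := (hV i (τ h) (fun l hl => h1 h l hl)).2 (by
      obtain ⟨r, hr, e⟩ := (h5 i).symm
      rw [← Module.End.mul_apply, e, LinearMap.smul_apply, Module.End.mul_apply, (h3 _).2 hh, smul_zero])
    obtain ⟨z, rfl⟩ := h2 g (fun l hl => hg1 l hl)
    obtain ⟨r, hr, e⟩ := (h4 i).symm
    refine ⟨r • z, (h3 _).1 ?_⟩
    have := LinearMap.congr_fun e z
    rw [Module.End.mul_apply, hg2] at this
    rw [map_sub, this, map_smul, map_smul]; simp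

lemma dual_one {D A B : Module.End k H} {I : Submodule k H} (φ : H →ₗ[k] k)
    (hA : ∀ h, A h ∈ I → ∃ h', h - B h' ∈ I) (hI : I ≤ LinearMap.ker φ) (hφ : φ ∘ₗ B = 0) :
    ∃ ψ : H →ₗ[k] k, I ≤ LinearMap.ker ψ ∧ ψ ∘ₗ A = φ := by
  have h1 : φ ∈ LinearMap.range (I.mkQ ∘ₗ A).dualMap := by
    rw [LinearMap.range_dualMap_eq_dualAnnihilator_ker, Submodule.mem_dualAnnihilator]
    intro w hw
    rw [LinearMap.mem_ker, LinearMap.comp_apply, Submodule.mkQ_apply,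
      Submodule.Quotient.mk_eq_zero] at hw
    obtain ⟨h', hh⟩ := hA w hw
    have := hI hh
    rw [LinearMap.mem_ker, map_sub, sub_eq_zero] at this
    rw [this]
    exact LinearMap.congr_fun hφ h'
  obtain ⟨ψ, rfl⟩ := h1
  refine ⟨ψ ∘ₗ I.mkQ, fun x hx => ?_, rfl⟩
  rw [LinearMap.mem_ker, LinearMap.comp_apply, Submodule.mkQ_apply,
    (Submodule.Quotient.mk_eq_zero I).2 hx, map_zero]

lemma VK_dual {D T : Fin c → Module.End k H} (hQ : QE D T) (hV : VK D T) (i : Fin c)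
    (φ : H →ₗ[k] k) (hφ : ∀ l < i, φ ∘ₗ D l = 0) :
    (φ ∘ₗ D i = 0 → ∃ ψ : H →ₗ[k] k, (∀ l < i, ψ ∘ₗ D l = 0) ∧ ψ ∘ₗ T i = φ) ∧
    (φ ∘ₗ T i = 0 → ∃ ψ : H →ₗ[k] k, (∀ l < i, ψ ∘ₗ D l = 0) ∧ ψ ∘ₗ D i = φ) := by
  obtain ⟨h1, h2⟩ := VK_dualish hQ hV i
  have hI : II D i.val ≤ LinearMap.ker φ := II_le D _ _ fun l hl x => LinearMap.congr_fun (hφ l hl) x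
  constructor
  · intro h
    obtain ⟨ψ, p1, p2⟩ := dual_one (D := D i) φ h2 hI h
    exact ⟨ψ, fun l hl => LinearMap.ext fun x => p1 (D_mem_II D l _ hl x), p2⟩
  · intro h
    obtain ⟨ψ, p1, p2⟩ := dual_one (D := D i) φ h1 hI h
    exact ⟨ψ, fun l hl => LinearMap.ext fun x => p1 (D_mem_II D l _ hl x), p2⟩

end AbsB

open CategoryTheory DirectSum

section TB
variable {k : Type} [Field k] {c : ℕ} {q : Fin c → Fin c → k} {a : Fin c → ℕ}
  (hqd : ∀ i, q i i = 1) (hqc : ∀ i j, q i j * q j i = 1) 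

include hqd hqc in
lemma hom_QE (M N : TM k c q a) : QE (Dop M N) (Top' M N) where
  DD i j := ⟨q i j, left_ne_zero_of_mul_eq_one (hqc i j), (hom_QS hqd hqc M N).DD i j⟩
  TD i j := ⟨_, pow_ne_zero _ (left_ne_zero_of_mul_eq_one (hqc i j)), (hom_QS hqd hqc M N).TD i j⟩
  TT i j := ⟨_, pow_ne_zero _ (left_ne_zero_of_mul_eq_one (hqc i j)), (hom_QS hqd hqc M N).TT hqc i j⟩
  DT0 i := (hom_QS hqd hqc M N).Dnrm hqd i
  TD0 i := (hom_QS hqd hqc M N).nrmD hqd i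

lemma WW_VK (M N : TM k c q a) : WW c M N ↔ VK (Dop M N) (Top' M N) := by
  have h : ∀ i : Fin c, (fun l : Fin c => l < i ∨ c ≤ l.val) = fun l => l < i := by
    intro i; funext l; have := l.2; simp only [eq_iff_iff]; 
    constructor
    · rintro (h | h)
      · exact h
      · omega
    · exact Or.inl
  constructor
  · intro hW i g hg
    have := hW i i.2
    rw [h] at this
    exact this g hg
  · intro hV i _
    rw [h]
    exact fun g hg => hV i g hg

/-- conjugation -/
def Cop (M N : TM k c q a) (i : Fin c) : (Module.End k (M.V →ₗ[k] N.V))ˣ where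
  val := { toFun := fun g => (N.Θ i)⁻¹.val ∘ₗ g ∘ₗ (M.Θ i).val
           map_add' := fun f g => by ext; simp
           map_smul' := fun f g => by ext; simp }
  inv := { toFun := fun g => (N.Θ i).val ∘ₗ g ∘ₗ (M.Θ i)⁻¹.val
           map_add' := fun f g => by ext; simp
           map_smul' := fun f g => by ext; simp }
  val_inv := by
    refine LinearMap.ext fun g => LinearMap.ext fun m => ?_
    change (((N.Θ i)⁻¹.val * (N.Θ i).val) (g (((M.Θ i)⁻¹.val * (M.Θ i).val) m))) = g m
    rw [Units.inv_mul, Units.inv_mul]; rfl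
  inv_val := by
    refine LinearMap.ext fun g => LinearMap.ext fun m => ?_
    change (((N.Θ i).val * (N.Θ i)⁻¹.val) (g (((M.Θ i).val * (M.Θ i)⁻¹.val) m))) = g m
    rw [Units.mul_inv, Units.mul_inv]; rfl

lemma Cop_apply (M N : TM k c q a) (i : Fin c) (g : M.V →ₗ[k] N.V) (m : M.V) :
    (Cop M N i).val g m = (N.Θ i)⁻¹.val (g ((M.Θ i).val m)) := rfl

lemma Θ_Θi (M : TM k c q a) (i j : Fin c) :
    (M.Θ i).val * (M.Θ j)⁻¹.val = (M.Θ j)⁻¹.val * (M.Θ i).val := by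
  have := (M.Θcomm i j).inv_right
  exact congrArg Units.val this.eq

include hqc in
lemma y_Θ' (M : TM k c q a) (i j : Fin c) :
    M.y j * (M.Θ i).val = q j i • ((M.Θ i).val * M.y j) := by
  rw [TM.y, mul_assoc, ← Θ_Θi, ← mul_assoc, M.XΘ hqc, smul_mul_assoc, mul_assoc]

include hqc in
lemma Cop_L (M N : TM k c q a) (i j : Fin c) :
    (Cop M N i).val * Lop M N j = q j i • (Lop M N j * (Cop M N i).val) := by
  refine LinearMap.ext fun g => LinearMap.ext fun m => ?_
  simp only [Module.End.mul_apply, LinearMap.smul_apply, Lop_apply, Cop_apply]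
  rw [← Module.End.mul_apply (M.Θ j)⁻¹.val, ← Θ_Θi, ← Module.End.mul_apply (N.Θ i)⁻¹.val, N.ΘiX hqc]
  rfl

include hqc in
lemma Cop_R (M N : TM k c q a) (i j : Fin c) :
    (Cop M N i).val * Rop M N j = q j i • (Rop M N j * (Cop M N i).val) := by
  refine LinearMap.ext fun g => LinearMap.ext fun m => ?_
  simp only [Module.End.mul_apply, LinearMap.smul_apply, Rop_apply, Cop_apply]
  rw [← Module.End.mul_apply (M.y j), y_Θ' hqc, LinearMap.smul_apply, map_smul, map_smul]
  rfl

include hqc in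
lemma Cop_D (M N : TM k c q a) (i j : Fin c) :
    (Cop M N i).val * Dop M N j = q j i • (Dop M N j * (Cop M N i).val) := by
  rw [Dop, mul_sub, sub_mul, Cop_L hqc, Cop_R hqc, smul_sub]

include hqc in
lemma Cop_T (M N : TM k c q a) (i j : Fin c) :
    (Cop M N i).val * Top' M N j = q j i ^ (a j - 1) • (Top' M N j * (Cop M N i).val) :=
  nrm_qcomm' (hqc j i) (Cop_L hqc M N i j) (Cop_R hqc M N i j) _

/-- trace pairing -/
def Bp (M N : TM k c q a) : (N.V →ₗ[k] M.V) →ₗ[k] Module.Dual k (M.V →ₗ[k] N.V) where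
  toFun g := LinearMap.trace k M.V ∘ₗ (LinearMap.llcomp k M.V N.V M.V g)
  map_add' f g := by ext; simp
  map_smul' f g := by ext; simp

lemma Bp_apply (M N : TM k c q a) (g : N.V →ₗ[k] M.V) (h : M.V →ₗ[k] N.V) :
    Bp M N g h = LinearMap.trace k M.V (g ∘ₗ h) := rfl

lemma Bp_inj (M N : TM k c q a) [Module.Finite k M.V] : Function.Injective (Bp M N) := by
  rw [injective_iff_map_eq_zero]
  intro g hg
  refine LinearMap.ext fun n => ?_
  rw [LinearMap.zero_apply, ← Module.forall_dual_apply_eq_zero_iff k]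
  intro φ
  have := LinearMap.congr_fun hg (φ.smulRight n)
  rw [Bp_apply] at this
  have e : g ∘ₗ φ.smulRight n = φ.smulRight (g n) := by ext; simp
  rwa [e, LinearMap.trace_smulRight] at this

lemma Bp_surj (M N : TM k c q a) [Module.Finite k M.V] [Module.Finite k N.V] :
    Function.Surjective (Bp M N) := by
  refine (LinearMap.injective_iff_surjective_of_finrank_eq_finrank ?_).1 (Bp_inj M N)
  rw [Subspace.dual_finrank_eq, Module.finrank_linearMap, Module.finrank_linearMap, mul_comm]

lemma Bp_L (M N : TM k c q a) (i : Fin c) (g : N.V →ₗ[k] M.V) :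
    Bp M N (Lop N M i g) = Bp M N g ∘ₗ ((Cop M N i).val * Rop M N i) := by
  refine LinearMap.ext fun h => ?_
  rw [LinearMap.comp_apply, Bp_apply, Bp_apply]
  have e1 : Lop N M i g ∘ₗ h = M.X i * (g ∘ₗ (N.Θ i)⁻¹.val ∘ₗ h) := rfl
  have e2 : g ∘ₗ ((Cop M N i).val * Rop M N i) h = (g ∘ₗ (N.Θ i)⁻¹.val ∘ₗ h) * M.X i := by
    refine LinearMap.ext fun m => ?_
    change g ((N.Θ i)⁻¹.val (h ((M.y i * (M.Θ i).val) m))) = _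
    rw [TM.y, mul_assoc, Units.inv_mul, mul_one]; rfl
  rw [e1, e2, LinearMap.trace_mul_comm]

include hqd hqc in
lemma Bp_R (M N : TM k c q a) (i : Fin c) (g : N.V →ₗ[k] M.V) :
    Bp M N (Rop N M i g) = Bp M N g ∘ₗ ((Cop M N i).val * Lop M N i) := by
  refine LinearMap.ext fun h => ?_
  rw [LinearMap.comp_apply, Bp_apply, Bp_apply]
  have e2 : g ∘ₗ ((Cop M N i).val * Lop M N i) h = Rop N M i g ∘ₗ h := by
    refine LinearMap.ext fun m => ?_
    change g (((N.Θ i)⁻¹.val * N.X i) (h (((M.Θ i)⁻¹.val * (M.Θ i).val) m))) = _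
    rw [Units.inv_mul, ← (N.X_Θi hqd hqc i).eq]; rfl
  rw [e2]

lemma semi_dual_pow {H H' : Type} [AddCommGroup H] [Module k H] [AddCommGroup H'] [Module k H']
    {B : H' →ₗ[k] Module.Dual k H} {A : Module.End k H'} {A' : Module.End k H}
    (h : ∀ g, B (A g) = B g ∘ₗ A') (s : ℕ) (g : H') : B ((A ^ s) g) = B g ∘ₗ (A' ^ s) := by
  induction s generalizing g with
  | zero => rfl
  | succ s ih =>
    rw [pow_succ, Module.End.mul_apply, ih, h, pow_succ', LinearMap.comp_assoc, Module.End.mul_eq_comp]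

include hqd hqc in
lemma Bp_D (M N : TM k c q a) (i : Fin c) (g : N.V →ₗ[k] M.V) :
    Bp M N (Dop N M i g) = - (Bp M N g ∘ₗ ((Cop M N i).val * Dop M N i)) := by
  rw [Dop, LinearMap.sub_apply, map_sub, Bp_L, Bp_R hqd hqc, Dop, mul_sub, LinearMap.comp_sub]
  abel

include hqd hqc in
lemma Bp_T (M N : TM k c q a) (i : Fin c) (g : N.V →ₗ[k] M.V) :
    Bp M N (Top' N M i g) = Bp M N g ∘ₗ ((Cop M N i).val ^ (a i - 1) * Top' M N i) := by
  have cL : Commute (Cop M N i).val (Lop M N i) := by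
    have := Cop_L hqc M N i i
    rwa [hqd, one_smul] at this
  have cR : Commute (Cop M N i).val (Rop M N i) := by
    have := Cop_R hqc M N i i
    rwa [hqd, one_smul] at this
  have cLR : Commute (Lop M N i) (Rop M N i) := by
    have := (hom_QS hqd hqc M N).LR i i
    rwa [hqd, one_smul] at this
  have e : (Cop M N i).val ^ (a i - 1) * Top' M N i = 
      ∑ s ∈ Finset.range (a i), ((Cop M N i).val * Lop M N i) ^ (a i - 1 - s) *
        ((Cop M N i).val * Rop M N i) ^ s := by
    rw [Top', nrm, Finset.mul_sum, ← Finset.sum_range_reflect]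
    refine Finset.sum_congr rfl fun s hs => ?_
    have hs := Finset.mem_range.1 hs
    rw [cL.mul_pow, cR.mul_pow, mul_assoc, ← mul_assoc (Lop M N i ^ _), 
      (cL.pow_pow s (a i - 1 - s)).symm.eq, mul_assoc, ← mul_assoc,
      show a i - 1 - (a i - 1 - s) = s by omega, mul_assoc (_ ^ (a i - 1)),
      ← mul_assoc ((Cop M N i).val ^ (a i - 1 - s)), ← pow_add,
      show a i - 1 - s + s = a i - 1 by omega]
  rw [e, Top', nrm, LinearMap.sum_apply, map_sum]
  refine LinearMap.ext fun h => ?_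
  simp only [LinearMap.sum_apply, LinearMap.comp_apply, map_sum]
  refine Finset.sum_congr rfl fun s hs => ?_
  rw [Module.End.mul_apply, semi_dual_pow (Bp_L M N i), semi_dual_pow (Bp_R hqd hqc M N i)]
  rfl

lemma unit_kill {H : Type} [AddCommGroup H] [Module k H] {U : (Module.End k H)ˣ} {D : Module.End k H}
    (h : QC U.val D) {ψ : H →ₗ[k] k} (hψ : ψ ∘ₗ D = 0) : (ψ ∘ₗ U⁻¹.val) ∘ₗ D = 0 := by
  obtain ⟨r, hr, e⟩ := h.symm
  have e2 : U⁻¹.val * D = r • (D * U⁻¹.val) := by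
    rw [Units.inv_mul_eq_iff_eq_mul, mul_smul_comm, ← mul_assoc, ← smul_mul_assoc, ← e, mul_assoc,
      Units.mul_inv, mul_one]
  rw [LinearMap.comp_assoc, ← Module.End.mul_eq_comp, e2, LinearMap.comp_smul, Module.End.mul_eq_comp,
    ← LinearMap.comp_assoc, hψ, LinearMap.zero_comp, smul_zero]

lemma unit_cancel {H : Type} [AddCommGroup H] [Module k H] {U : (Module.End k H)ˣ} {D : Module.End k H}
    (h : QC U.val D) {ψ : H →ₗ[k] k} : ψ ∘ₗ (U.val * D) = 0 ↔ ψ ∘ₗ D = 0 := by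
  obtain ⟨r, hr, e⟩ := h
  have : ψ ∘ₗ (U.val * D) = r • ((ψ ∘ₗ D) ∘ₗ U.val) := by
    rw [e, LinearMap.comp_smul]; rfl
  rw [this]
  constructor
  · intro h
    have h2 : (ψ ∘ₗ D) ∘ₗ U.val = 0 := (smul_eq_zero.1 h).resolve_left hr
    have h3 : ((ψ ∘ₗ D) ∘ₗ U.val) ∘ₗ U⁻¹.val = 0 := by rw [h2, LinearMap.zero_comp]
    rwa [LinearMap.comp_assoc, ← Module.End.mul_eq_comp, Units.mul_inv] at h3
  · intro h; rw [h, LinearMap.zero_comp, smul_zero]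

include hqd hqc in
theorem thmB (M N : TM k c q a) [Module.Finite k M.V] [Module.Finite k N.V] (h : WW c M N) :
    WW c N M := by
  rw [WW_VK] at h ⊢
  have qD : ∀ i l, QC (Cop M N i).val (Dop M N l) := fun i l =>
    ⟨_, left_ne_zero_of_mul_eq_one (hqc l i), Cop_D hqc M N i l⟩
  have qT : ∀ i l, QC (Cop M N i).val (Top' M N l) := fun i l =>
    ⟨_, pow_ne_zero _ (left_ne_zero_of_mul_eq_one (hqc l i)), Cop_T hqc M N i l⟩
  have kD : ∀ l g, Dop N M l g = 0 ↔ Bp M N g ∘ₗ Dop M N l = 0 := by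
    intro l g
    rw [← unit_cancel (qD l l), ← LinearMap.map_eq_zero_iff _ (Bp_inj M N), Bp_D hqd hqc,
      neg_eq_zero]
  have upow : ∀ i, ((Cop M N i) ^ (a i - 1)).val = (Cop M N i).val ^ (a i - 1) := fun i =>
    Units.val_pow_eq_pow_val _ _
  have kT : ∀ l g, Top' N M l g = 0 ↔ Bp M N g ∘ₗ Top' M N l = 0 := by
    intro l g
    rw [← unit_cancel (U := (Cop M N l) ^ (a l - 1)) (by rw [upow]; exact (qT l l).pow _), upow,
      ← Bp_T hqd hqc, LinearMap.map_eq_zero_iff _ (Bp_inj M N)]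
  intro i g hg
  obtain ⟨h1, h2⟩ := VK_dual (hom_QE hqd hqc M N) h i (Bp M N g) (fun l hl => (kD l g).1 (hg l hl))
  constructor
  · intro hD
    obtain ⟨ψ, p1, p2⟩ := h1 ((kD i g).1 hD)
    obtain ⟨g', hg'⟩ := Bp_surj M N (ψ ∘ₗ ((Cop M N i) ^ (a i - 1))⁻¹.val)
    refine ⟨g', fun l hl => (kD l g').2 ?_, Bp_inj M N ?_⟩
    · rw [hg']
      exact unit_kill (by rw [upow]; exact (qD i l).pow _) (p1 l hl)
    · rw [Bp_T hqd hqc, hg', ← upow, LinearMap.comp_assoc, ← Module.End.mul_eq_comp, Units.inv_mul_cancel_left,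
        p2]
  · intro hD
    obtain ⟨ψ, p1, p2⟩ := h2 ((kT i g).1 hD)
    obtain ⟨g', hg'⟩ := Bp_surj M N (-(ψ ∘ₗ (Cop M N i)⁻¹.val))
    refine ⟨g', fun l hl => (kD l g').2 ?_, Bp_inj M N ?_⟩
    · rw [hg', LinearMap.neg_comp, unit_kill (qD i l) (p1 l hl), neg_zero]
    · rw [Bp_D hqd hqc, hg', LinearMap.neg_comp, neg_neg, LinearMap.comp_assoc, ← Module.End.mul_eq_comp,
        Units.inv_mul_cancel_left, p2]
end TB

open CategoryTheory DirectSum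

section FinA
variable {k : Type} [Field k] {c : ℕ} {q : Fin c → Fin c → k} {a : Fin c → ℕ}

lemma qciX_comm_pow (i j : Fin c) (e : ℕ) :
    qciX k q a i * qciX k q a j ^ e = q i j ^ e • (qciX k q a j ^ e * qciX k q a i) := by
  induction e with
  | zero => simp
  | succ e ih =>
    rw [pow_succ, ← mul_assoc, ih, smul_mul_assoc, mul_assoc, qciX_comm, mul_smul_comm, smul_smul,
      ← mul_assoc, ← pow_succ]

lemma qci_stage (m : ℕ) (hm : m ≤ c) : ∃ W : Submodule k (QCI k c q a),
    W.FG ∧ 1 ∈ W ∧ ∀ i : Fin c, i.val < m → ∀ w ∈ W, qciX k q a i * w ∈ W := by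
  induction m with
  | zero => exact ⟨Submodule.span k {1}, Submodule.fg_span_singleton _,
      Submodule.mem_span_singleton_self _, fun i hi => absurd hi (Nat.not_lt_zero _)⟩
  | succ m ih =>
    obtain ⟨W, h1, h2, h3⟩ := ih (by omega)
    let j : Fin c := ⟨m, hm⟩
    let U : Fin (a j) → Submodule k (QCI k c q a) := fun e =>
      W.map (LinearMap.mulLeft k (qciX k q a j ^ e.val))
    have hU : ∀ (e : ℕ) (w : QCI k c q a), w ∈ W → qciX k q a j ^ e * w ∈ ⨆ e, U e := by
      intro e w hw
      by_cases he : e < a j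
      · exact (le_iSup U ⟨e, he⟩) ⟨w, hw, rfl⟩
      · rw [← Nat.sub_add_cancel (not_lt.1 he), pow_add, qciX_pow, mul_zero, zero_mul]
        exact Submodule.zero_mem _
    refine ⟨⨆ e, U e, Submodule.fg_iSup _ fun e => h1.map _, ?_, ?_⟩
    · simpa using hU 0 1 h2
    · intro i hi w hw
      have hle : (⨆ e, U e) ≤ (⨆ e, U e).comap (LinearMap.mulLeft k (qciX k q a i)) := by
        refine iSup_le fun e => ?_
        rintro _ ⟨v, hv, rfl⟩
        rw [Submodule.mem_comap, LinearMap.mulLeft_apply, LinearMap.mulLeft_apply, ← mul_assoc]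
        by_cases hij : i = j
        · rw [hij, ← pow_succ']
          exact hU _ _ hv
        · have him : i.val < m := by
            have : i.val ≠ m := fun h => hij (Fin.ext h)
            omega
          rw [qciX_comm_pow, smul_mul_assoc, mul_assoc]
          exact Submodule.smul_mem _ _ (hU _ _ (h3 i him v hv))
      exact hle hw

lemma qci_finite : Module.Finite k (QCI k c q a) := by
  obtain ⟨W, h1, h2, h3⟩ := qci_stage (k := k) (q := q) (a := a) c le_rfl
  have h : ∀ x : QCI k c q a, ∀ w ∈ W, x * w ∈ W := by
    intro x
    induction x using qci_induction with
    | h0 r => intro w hw; rw [← Algebra.smul_def]; exact W.smul_mem _ hw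
    | hX i => exact h3 i i.2
    | hmul x y hx hy => intro w hw; rw [mul_assoc]; exact hx _ (hy _ hw)
    | hadd x y hx hy => intro w hw; rw [add_mul]; exact W.add_mem (hx _ hw) (hy _ hw)
  have : W = ⊤ := by
    rw [eq_top_iff]
    intro x _
    simpa using h x 1 h2
  exact ⟨this ▸ h1⟩

end FinA

section Scal
variable {k : Type} [Field k] {ι : Type} [DecidableEq ι] {M : Type} [AddCommGroup M] [Module k M]
  (ℳ : ι → Submodule k M) [DirectSum.Decomposition ℳ]

lemma hom_ext_graded {P : Type} [AddCommGroup P] [Module k P] {f g : M →ₗ[k] P}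
    (h : ∀ d, ∀ m ∈ ℳ d, f m = g m) : f = g := by
  refine LinearMap.ext fun m => ?_
  induction m using DirectSum.Decomposition.inductionOn ℳ with
  | zero => simp
  | homogeneous m => exact h _ _ m.2
  | add m m' h1 h2 => rw [map_add, map_add, h1, h2]

/-- Scaling by a function of the degree. -/
def scal (f : ι → k) : Module.End k M :=
  (DirectSum.toModule k ι M fun d => f d • (ℳ d).subtype) ∘ₗ
    (DirectSum.decomposeLinearEquiv ℳ).toLinearMap

lemma scal_apply (f : ι → k) (d : ι) (m : M) (hm : m ∈ ℳ d) : scal ℳ f m = f d • m := by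
  rw [scal, LinearMap.comp_apply]
  change DirectSum.toModule k ι M _ (DirectSum.decompose ℳ m) = _
  rw [DirectSum.decompose_of_mem ℳ hm]
  change DirectSum.toModule k ι M _ (DirectSum.lof k ι (fun d => ℳ d) d ⟨m, hm⟩) = _
  rw [DirectSum.toModule_lof]
  rfl

lemma scal_mul (f g : ι → k) : scal ℳ f * scal ℳ g = scal ℳ (f * g) := by
  refine hom_ext_graded ℳ fun d m hm => ?_
  rw [Module.End.mul_apply, scal_apply ℳ g d m hm, map_smul, scal_apply ℳ f d m hm,
    scal_apply ℳ _ d m hm, smul_smul, mul_comm, Pi.mul_apply]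

lemma scal_one : scal ℳ (1 : ι → k) = 1 := by
  refine hom_ext_graded ℳ fun d m hm => ?_
  rw [scal_apply ℳ _ d m hm]; simp

/-- Scaling as a unit. -/
def scalU (f : ι → kˣ) : (Module.End k M)ˣ where
  val := scal ℳ fun d => (f d : k)
  inv := scal ℳ fun d => ((f d)⁻¹ : kˣ)
  val_inv := by
    rw [scal_mul, ← scal_one ℳ]; congr 1; ext d; simp
  inv_val := by
    rw [scal_mul, ← scal_one ℳ]; congr 1; ext d; simp
end Scal

section Gr
variable {k : Type} [Field k] {c : ℕ} {q : Fin c → Fin c → k} {a : Fin c → ℕ}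
  (hqc : ∀ i j, q i j * q j i = 1)

/-- Commutation scalars as units. -/
def qU (hqc : ∀ i j, q i j * q j i = 1) (i j : Fin c) : kˣ :=
  ⟨q i j, q j i, hqc i j, hqc j i⟩

/-- A graded module gives a twisted representation. -/
def grTM (M : Type) [AddCommGroup M] [Module (QCI k c q a) M]
    [Module k M] [IsScalarTower k (QCI k c q a) M]
    (ℳ : (Fin c → ℤ) → Submodule k M) [DirectSum.Decomposition ℳ]
    (hℳ : ∀ i e, ∀ m ∈ ℳ e, qciX k q a i • m ∈ ℳ (Pi.single i 1 + e)) : TM k c q a where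
  V := M
  X := opN q a M
  Θ i := scalU ℳ fun d => ∏ j, qU hqc i j ^ d j
  rep := opN_rep M
  Θcomm i j := by
    refine Units.ext ?_
    change scal ℳ _ * scal ℳ _ = scal ℳ _ * scal ℳ _
    rw [scal_mul, scal_mul, mul_comm]
  ΘX i j := by
    refine hom_ext_graded ℳ fun d m hm => ?_
    change scal ℳ _ (qciX k q a j • m) = q i j • (opN q a M j (scal ℳ _ m))
    rw [scal_apply ℳ _ _ _ (hℳ j d m hm), scal_apply ℳ _ d m hm, map_smul, smul_smul, opN_apply]
    congr 1
    simp only [Pi.add_apply, zpow_add, Finset.prod_mul_distrib]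
    rw [Units.val_mul, Finset.prod_eq_single j]
    · simp [qU]
    · intro b _ hb; simp [Pi.single_eq_of_ne hb]
    · simp

/-- The identity as an isomorphism. -/
def grIso (T : TM k c q a) (M : Type) [AddCommGroup M] [Module (QCI k c q a) M]
    [Module k M] [IsScalarTower k (QCI k c q a) M] (e : M ≃ₗ[k] T.V)
    (h : ∀ i m, e (opN q a M i m) = T.X i (e m)) : M ≃ₗ[QCI k c q a] T.Mod :=
  { mkLin (Q := T.Mod) (e : M →ₗ[k] T.V) (by
      intro i p; rw [T.opN_eq]; exact h i p) with
    invFun := e.symm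
    left_inv := e.symm_apply_apply
    right_inv := e.apply_symm_apply }

lemma Ev_congr {A : Type} [Ring A] {M M' N N' : Type} [AddCommGroup M] [AddCommGroup M']
    [AddCommGroup N] [AddCommGroup N'] [Module A M] [Module A M'] [Module A N] [Module A N']
    (e : M ≃ₗ[A] M') (f : N ≃ₗ[A] N') (n : ℕ) (h : Ev A M' N' n) : Ev A M N n := by
  unfold Ev at *
  refine ⟨fun x y => ?_⟩
  have key : ∀ z : Abelian.Ext (ModuleCat.of A M) (ModuleCat.of A N) n, 
      z = (Abelian.Ext.mk₀ e.toModuleIso.hom).comp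
        (((Abelian.Ext.mk₀ e.toModuleIso.inv).comp z (zero_add n)).comp
          (Abelian.Ext.mk₀ f.toModuleIso.hom) (add_zero n) |>.comp 
          (Abelian.Ext.mk₀ f.toModuleIso.inv) (add_zero n)) (zero_add n) := by
    intro z
    have he : e.toModuleIso.hom ≫ e.toModuleIso.inv = 𝟙 (ModuleCat.of A M) := e.toModuleIso.hom_inv_id
    have hf : f.toModuleIso.hom ≫ f.toModuleIso.inv = 𝟙 (ModuleCat.of A N) := f.toModuleIso.hom_inv_id
    simp only [Abelian.Ext.comp_assoc_of_third_deg_zero, Abelian.Ext.mk₀_comp_mk₀,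
      Abelian.Ext.mk₀_comp_mk₀_assoc]
    rw [he, hf, Abelian.Ext.mk₀_id_comp, Abelian.Ext.comp_mk₀_id]
  rw [key x, key y]
  congr 2
  exact Subsingleton.elim _ _

lemma qci_key (hqd : ∀ i, q i i = 1) (hqc : ∀ i j, q i j * q j i = 1) (ha : ∀ i, 2 ≤ a i)
    (M N : Type)
    [AddCommGroup M] [Module (QCI k c q a) M] [Module.Finite (QCI k c q a) M]
    [Module k M] [IsScalarTower k (QCI k c q a) M]
    [AddCommGroup N] [Module (QCI k c q a) N] [Module.Finite (QCI k c q a) N]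
    [Module k N] [IsScalarTower k (QCI k c q a) N]
    (ℳ : (Fin c → ℤ) → Submodule k M) [DirectSum.Decomposition ℳ]
    (hℳ : ∀ i e, ∀ m ∈ ℳ e, qciX k q a i • m ∈ ℳ (Pi.single i 1 + e))
    (𝒩 : (Fin c → ℤ) → Submodule k N) [DirectSum.Decomposition 𝒩]
    (h𝒩 : ∀ i e, ∀ m ∈ 𝒩 e, qciX k q a i • m ∈ 𝒩 (Pi.single i 1 + e))
    (h : ∃ n₀ : ℕ, ∀ i ≥ n₀, extVanish (QCI k c q a) M N i) :
    ∀ i > 0, extVanish (QCI k c q a) N M i := by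
  haveI : Module.Finite k (QCI k c q a) := qci_finite
  let TM' := grTM hqc M ℳ hℳ
  let TN := grTM hqc N 𝒩 h𝒩
  haveI : Module.Finite k TM'.V := Module.Finite.trans (R := k) (QCI k c q a) M
  haveI : Module.Finite k TN.V := Module.Finite.trans (R := k) (QCI k c q a) N
  let eM : M ≃ₗ[QCI k c q a] TM'.Mod := grIso TM' M (LinearEquiv.refl k M) fun _ _ => rfl
  let eN : N ≃ₗ[QCI k c q a] TN.Mod := grIso TN N (LinearEquiv.refl k N) fun _ _ => rfl
  obtain ⟨n₀, h⟩ := h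
  have h1 : WW c TM' TN := by
    refine (thmA hqd hqc ha TN c le_rfl TM' (rproj_c TM')).1 ⟨n₀ + 1, fun n hn => ?_⟩
    obtain ⟨n, rfl⟩ : ∃ m, n = m + 1 := ⟨n - 1, by omega⟩
    exact Ev_congr eM.symm eN.symm _ ((extVanish_iff M N n).1 (h _ (by omega)))
  have h2 : WW c TN TM' := thmB hqd hqc TM' TN h1
  intro i hi
  obtain ⟨n, rfl⟩ : ∃ m, i = m + 1 := ⟨i - 1, by omega⟩
  exact (extVanish_iff N M n).2 (Ev_congr eN eM _
    ((thmA hqd hqc ha TM' c le_rfl TN (rproj_c TN)).2 h2 n))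
end Gr

theorem ext_symmetry_graded_qci
    (k : Type) [Field k] (c : ℕ) (hc : 1 ≤ c)
    (q : Fin c → Fin c → k) (a : Fin c → ℕ)
    (hqd : ∀ i, q i i = 1) (hqc : ∀ i j, q i j * q j i = 1) (ha : ∀ i, 2 ≤ a i)
    (hroot : ∀ i j, ∃ n : ℕ, 0 < n ∧ q i j ^ n = 1)
    -- the ℤ^c-grading on A, with deg x_i the i-th standard basis vector
    (𝒜 : (Fin c → ℤ) → Submodule k (QCI k c q a)) [GradedAlgebra 𝒜]
    (h𝒜 : ∀ i : Fin c, qciX k q a i ∈ 𝒜 (Pi.single i 1))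
    -- M and N are finitely generated graded A-modules
    (M N : Type)
    [AddCommGroup M] [Module (QCI k c q a) M] [Module.Finite (QCI k c q a) M]
    [Module k M] [IsScalarTower k (QCI k c q a) M]
    [AddCommGroup N] [Module (QCI k c q a) N] [Module.Finite (QCI k c q a) N]
    [Module k N] [IsScalarTower k (QCI k c q a) N]
    (ℳ : (Fin c → ℤ) → Submodule k M) [DirectSum.Decomposition ℳ]
    (hℳ : ∀ (d e : Fin c → ℤ), ∀ x ∈ 𝒜 d, ∀ m ∈ ℳ e, x • m ∈ ℳ (d + e))
    (𝒩 : (Fin c → ℤ) → Submodule k N) [DirectSum.Decomposition 𝒩]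
    (h𝒩 : ∀ (d e : Fin c → ℤ), ∀ x ∈ 𝒜 d, ∀ n ∈ 𝒩 e, x • n ∈ 𝒩 (d + e)) :
    List.TFAE
      [∃ n₀ : ℕ, ∀ i ≥ n₀, extVanish (QCI k c q a) M N i,
       ∀ i > 0, extVanish (QCI k c q a) M N i,
       ∃ n₀ : ℕ, ∀ i ≥ n₀, extVanish (QCI k c q a) N M i,
       ∀ i > 0, extVanish (QCI k c q a) N M i] := by
  have hM : ∀ i e, ∀ m ∈ ℳ e, qciX k q a i • m ∈ ℳ (Pi.single i 1 + e) :=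
    fun i e m hm => hℳ _ _ _ (h𝒜 i) _ hm
  have hN : ∀ i e, ∀ m ∈ 𝒩 e, qciX k q a i • m ∈ 𝒩 (Pi.single i 1 + e) :=
    fun i e m hm => h𝒩 _ _ _ (h𝒜 i) _ hm
  tfae_have 1 → 4 := qci_key hqd hqc ha M N ℳ hM 𝒩 hN
  tfae_have 4 → 3 := fun h => ⟨1, fun i hi => h i hi⟩
  tfae_have 3 → 2 := qci_key hqd hqc ha N M 𝒩 hN ℳ hM
  tfae_have 2 → 1 := fun h => ⟨1, fun i hi => h i hi⟩
  tfae_finish
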